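/- arXiv:1309.0232 — 3 statements merged into one kernel-verified Lean document; each statement's English description precedes it below -/
import Mathlib

section
/- Let Q be an orthogonal projection on H with ‖(I − Q)E(Δ)‖ = 0. Then λ_1 + i, …, λ_d + i are eigenvalues of T + iQ, each λ_j + i is semi-simple (its algebraic and geometric eigenspaces coincide, equal to the eigenspace L({λ_j}) of T at λ_j), the span of the corresponding eigenvectors is exactly L(Δ), and U(a,b) ⊂ ρ(T + iQ). -/
open scoped ComplexInnerProductSpace

noncomputable section

variable {H : Type*} [NormedAddCommGroup H] [InnerProductSpace ℂ H] [CompleteSpace H]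

/-- The resolvent set of a (possibly unbounded) operator given as a `LinearPMap`. -/
def pmResolventSet (T : H →ₗ.[ℂ] H) : Set ℂ :=
  {z | ∃ R : H →L[ℂ] H, (∀ y : H, ∃ hy : R y ∈ T.domain, T ⟨R y, hy⟩ - z • R y = y) ∧
        ∀ x : T.domain, R (T x - z • (x : H)) = x}

/-- The spectrum of a (possibly unbounded) operator given as a `LinearPMap`. -/
def pmSpectrum (T : H →ₗ.[ℂ] H) : Set ℂ := (pmResolventSet T)ᶜ

/-- The eigenspace of a (possibly unbounded) operator given as a `LinearPMap`. -/
def pmEigenspace (T : H →ₗ.[ℂ] H) (z : ℂ) : Submodule ℂ H where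
  carrier := {φ | ∃ h : φ ∈ T.domain, T ⟨φ, h⟩ = z • φ}
  add_mem' := by
    rintro a b ⟨ha, hTa⟩ ⟨hb, hTb⟩
    refine ⟨add_mem ha hb, ?_⟩
    have : (⟨a + b, add_mem ha hb⟩ : T.domain) = ⟨a, ha⟩ + ⟨b, hb⟩ := rfl
    rw [this, T.map_add, hTa, hTb, smul_add]
  zero_mem' := ⟨zero_mem _, by
    have : (⟨0, zero_mem _⟩ : T.domain) = 0 := rfl
    rw [this, T.map_zero, smul_zero]⟩
  smul_mem' := by
    rintro c a ⟨ha, hTa⟩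
    refine ⟨Submodule.smul_mem _ c ha, ?_⟩
    have : (⟨c • a, Submodule.smul_mem _ c ha⟩ : T.domain) = c • ⟨a, ha⟩ := rfl
    rw [this, T.map_smul, hTa, smul_comm]

/-- The discrete spectrum: isolated eigenvalues of finite multiplicity. -/
def pmDiscSpectrum (T : H →ₗ.[ℂ] H) : Set ℂ :=
  {z | z ∈ pmSpectrum T ∧ (∃ ε > 0, ∀ w ∈ pmSpectrum T, w ≠ z → ε ≤ dist w z) ∧
    pmEigenspace T z ≠ ⊥ ∧ FiniteDimensional ℂ (pmEigenspace T z)}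

/-- The region `U(a,b)`: all `z` with `a < Re z < b` lying in the exterior of the two circles
of radius `1` centred at `a` and at `b`, and with `z ≠ λ_j + i` for all `j`. -/
def Uab (a b : ℝ) {d : ℕ} (lam : Fin d → ℝ) : Set ℂ :=
  {z | a < z.re ∧ z.re < b ∧ 1 < dist z (a : ℂ) ∧ 1 < dist z (b : ℂ) ∧
    ∀ j, z ≠ (lam j : ℂ) + Complex.I}

/-- The resolvent set of the perturbed operator `T + B`, where `B` is bounded. -/
def pertResolventSet (T : H →ₗ.[ℂ] H) (B : H →L[ℂ] H) : Set ℂ :=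
  {z | ∃ R : H →L[ℂ] H,
    (∀ y : H, ∃ hy : R y ∈ T.domain, T ⟨R y, hy⟩ + B (R y) - z • R y = y) ∧
      ∀ x : T.domain, R (T x + B (x : H) - z • (x : H)) = x}

/-- The spectrum of the perturbed operator `T + B`. -/
def pertSpectrum (T : H →ₗ.[ℂ] H) (B : H →L[ℂ] H) : Set ℂ := (pertResolventSet T B)ᶜ

/-- The eigenspace of the perturbed operator `T + B` at `z`. -/
def pertEigenspace (T : H →ₗ.[ℂ] H) (B : H →L[ℂ] H) (z : ℂ) : Submodule ℂ H where
  carrier := {φ | ∃ h : φ ∈ T.domain, T ⟨φ, h⟩ + B φ = z • φ}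
  add_mem' := by
    rintro x y ⟨hx, hTx⟩ ⟨hy, hTy⟩
    refine ⟨add_mem hx hy, ?_⟩
    have : (⟨x + y, add_mem hx hy⟩ : T.domain) = ⟨x, hx⟩ + ⟨y, hy⟩ := rfl
    rw [this, T.map_add, map_add]
    rw [show T ⟨x, hx⟩ + T ⟨y, hy⟩ + (B x + B y)
        = (T ⟨x, hx⟩ + B x) + (T ⟨y, hy⟩ + B y) by abel]
    rw [hTx, hTy, smul_add]
  zero_mem' := ⟨zero_mem _, by
    have : (⟨0, zero_mem _⟩ : T.domain) = 0 := rfl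
    rw [this, T.map_zero, map_zero, add_zero, smul_zero]⟩
  smul_mem' := by
    rintro c x ⟨hx, hTx⟩
    refine ⟨Submodule.smul_mem _ c hx, ?_⟩
    have : (⟨c • x, Submodule.smul_mem _ c hx⟩ : T.domain) = c • ⟨x, hx⟩ := rfl
    rw [this, T.map_smul, map_smul, ← smul_add, hTx, smul_comm]

theorem aux_mul (A B : H →L[ℂ] H) (v : H) : (A * B) v = A (B v) := rfl

theorem aux_re_symm (u t : H) : (⟪t, u⟫ : ℂ).re = (⟪u, t⟫ : ℂ).re := by
  rw [← inner_conj_symm t u, Complex.conj_re]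

theorem aux_im_symm (u t : H) : (⟪t, u⟫ : ℂ).im = -(⟪u, t⟫ : ℂ).im := by
  rw [← inner_conj_symm t u, Complex.conj_im]

theorem aux_bdd (R E : H →L[ℂ] H) (hR : IsSelfAdjoint R) (hc : Commute R E) (κ : ℝ)
    (ms : List ℝ)
    (hinj : ∀ μ ∈ ms, ∀ w, E w = 0 → R w = (μ : ℂ) • w → w = 0)
    (hsp : ∀ μ ∈ spectrum ℝ R, κ < μ → μ ∈ ms) (v : H) (hv : E v = 0) :
    (⟪v, R v⟫ : ℂ).re ≤ κ * ‖v‖ ^ 2 := by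
  set f : ℝ → ℝ := fun t => max (t - κ) 0 with hf
  have hfc : Continuous f := by fun_prop
  have key : ∀ l : List ℝ, (∀ μ ∈ l, μ ∈ ms) → ∀ g : ℝ → ℝ, Continuous g →
      (cfc (fun t => (l.map (fun μ => t - μ)).prod * g t) R) v = 0 → (cfc g R) v = 0 := by
    intro l
    induction l with
    | nil => intro _ g _ h; simpa using h
    | cons μ l ih =>
      intro hl g hg h
      apply ih (fun x hx => hl x (List.mem_cons_of_mem _ hx)) g hg
      have hcont : Continuous (fun t => (l.map (fun μ => t - μ)).prod * g t) := by
        refine Continuous.mul ?_ hg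
        exact continuous_list_prod _ (fun i _ => by fun_prop)
      set G : ℝ → ℝ := fun t => (l.map (fun μ => t - μ)).prod * g t with hG
      have h1 : (fun t => ((μ :: l).map (fun μ => t - μ)).prod * g t)
          = fun t => (t - μ) * G t := by
        funext t; simp [hG, mul_assoc]
      rw [h1, cfc_mul (fun t => t - μ) G R (by fun_prop) hcont.continuousOn,
        cfc_sub (fun t => t) (fun _ => μ) R, cfc_id' ℝ R, cfc_const μ R] at h
      apply hinj μ (hl μ List.mem_cons_self)
      · have := (hc.cfc_real G)
        have h2 := congrArg (fun A : H →L[ℂ] H => A v) this.eq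
        simp only [aux_mul, hv, map_zero] at h2
        exact h2.symm
      · simp only [aux_mul, _root_.sub_apply] at h
        rw [sub_eq_zero] at h
        rw [h, Algebra.algebraMap_eq_smul_one]
        simp
  have hfv : cfc f R v = 0 := by
    apply key ms (fun _ h => h) f hfc
    have : cfc (fun t => (ms.map (fun μ => t - μ)).prod * f t) R = cfc (fun _ => (0 : ℝ)) R := by
      apply cfc_congr
      intro t ht
      by_cases h : κ < t
      · have := hsp t ht h
        have h0 : (ms.map (fun μ => t - μ)).prod = 0 := by
          apply List.prod_eq_zero
          exact List.mem_map.2 ⟨t, this, sub_self t⟩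
        simp [h0]
      · have : f t = 0 := by simp only [hf]; exact max_eq_right (by linarith)
        simp [this]
    rw [this, cfc_const (0 : ℝ) R]; simp
  have hmono : cfc (fun t => t - κ) R ≤ cfc f R :=
    cfc_mono (fun x _ => le_max_left _ _) (by fun_prop) hfc.continuousOn
  rw [cfc_sub (fun t => t) (fun _ => κ) R, cfc_id' ℝ R, cfc_const κ R,
    ContinuousLinearMap.le_def] at hmono
  have h3 := hmono.re_inner_nonneg_right v
  simp only [_root_.sub_apply, hfv, Algebra.algebraMap_eq_smul_one] at h3
  have h4 : (⟪v, (κ • (1 : H →L[ℂ] H)) v⟫ : ℂ).re = κ * ‖v‖ ^ 2 := by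
    have : (κ • (1 : H →L[ℂ] H)) v = (κ : ℂ) • v := by simp
    rw [this, inner_smul_right, inner_self_eq_norm_sq_to_K, Complex.re_ofReal_mul]
    congr 1
    norm_cast
  simp only [inner_sub_right, inner_zero_right, RCLike.re_to_complex, Complex.sub_re,
    Complex.zero_re] at h3
  linarith

/-- numeric core of the lower bound -/
theorem aux_num (a b x n q s : ℝ) (hab : a < b) 
    (h : (b - a) * (q - a * n) ≤ s - 2 * a * q + a ^ 2 * n)
    (ha : 0 ≤ s - 2 * a * q + a ^ 2 * n) (hb : 0 ≤ s - 2 * b * q + b ^ 2 * n)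
    (hxa : a < x) (hxb : x < b) :
    (x - a) ^ 2 * n ≤ s - 2 * x * q + x ^ 2 * n ∨
    (b - x) ^ 2 * n ≤ s - 2 * x * q + x ^ 2 * n := by
  rcases le_total x ((a + b) / 2) with hx | hx
  · left
    rcases le_total (a * n) q with hq | hq
    · nlinarith [mul_nonneg (sub_nonneg.2 hq) (by linarith : (0:ℝ) ≤ b - a - 2 * (x - a))]
    · nlinarith [mul_nonneg (sub_nonneg.2 hq) (by linarith : (0:ℝ) ≤ x - a)]
  · right
    rcases le_total q (b * n) with hq | hq
    · nlinarith [mul_nonneg (sub_nonneg.2 hq) (by linarith : (0:ℝ) ≤ b - a - 2 * (b - x))]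
    · nlinarith [mul_nonneg (sub_nonneg.2 hq) (by linarith : (0:ℝ) ≤ b - x)]

theorem aux_normsq (u t : H) (z : ℂ) (hreal : (⟪u, t⟫ : ℂ).im = 0) :
    ‖t - z • u‖ ^ 2 = ‖t‖ ^ 2 - 2 * z.re * (⟪u, t⟫ : ℂ).re + z.re ^ 2 * ‖u‖ ^ 2
      + z.im ^ 2 * ‖u‖ ^ 2 := by
  rw [@norm_sub_sq ℂ, inner_smul_right, norm_smul, mul_pow, Complex.sq_norm, Complex.normSq_apply]
  simp [aux_re_symm u t, aux_im_symm u t, hreal]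
  ring

theorem aux_lower (g : Submodule ℂ (H × H))
    (hsym : ∀ x y u v : H, (x, y) ∈ g → (u, v) ∈ g → (⟪y, u⟫ : ℂ) = ⟪x, v⟫)
    (E : H →L[ℂ] H) (hEg : ∀ x y, (x, y) ∈ g → (E x, E y) ∈ g)
    (hfun : ∀ y, ((0 : H), y) ∈ g → y = 0)
    (a b : ℝ) (hab : a < b) (Ra : H →L[ℂ] H)
    (hR1 : ∀ y, (Ra y, y + (a : ℂ) • Ra y) ∈ g)
    (hR2 : ∀ x y, (x, y) ∈ g → Ra (y - (a : ℂ) • x) = x)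
    (ls : List ℝ)
    (hls : ∀ l ∈ ls, l ≠ a ∧ ∀ x, (x, (l : ℂ) • x) ∈ g → E x = x)
    (hres : ∀ l : ℝ, a < l → l ≤ b → l ∉ ls → ∃ R : H →L[ℂ] H,
      (∀ y, (R y, y + (l : ℂ) • R y) ∈ g) ∧ ∀ x y, (x, y) ∈ g → R (y - (l : ℂ) • x) = x)
    (u t : H) (hut : (u, t) ∈ g) (hEu : E u = 0) :
    (b - a) * ((⟪u, t⟫ : ℂ).re - a * ‖u‖ ^ 2) ≤ ‖t - (a : ℂ) • u‖ ^ 2 := by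
  have hba : 0 < b - a := sub_pos.2 hab
  have hRsa : IsSelfAdjoint Ra := by
    rw [ContinuousLinearMap.isSelfAdjoint_iff_isSymmetric]
    intro x y
    have h := hsym _ _ _ _ (hR1 x) (hR1 y)
    simp only [inner_add_left, inner_add_right, inner_smul_left, inner_smul_right,
      Complex.conj_ofReal] at h
    have := add_right_cancel h
    exact this.symm
  have hcomm : Commute Ra E := by
    ext y
    simp only [aux_mul]
    have h := hR2 _ _ (hEg _ _ (hR1 y))
    rw [map_add, map_smul, add_sub_cancel_right] at h
    exact h
  have hEt : E t = 0 := by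
    have := hEg _ _ hut
    rw [hEu] at this
    exact hfun _ this
  have key := aux_bdd Ra E hRsa hcomm (1 / (b - a)) (ls.map fun l => 1 / (l - a)) ?_ ?_
    (t - (a : ℂ) • u) (by simp [hEt, hEu])
  · rw [hR2 _ _ hut, inner_sub_left, inner_smul_left, Complex.conj_ofReal, Complex.sub_re,
      Complex.re_ofReal_mul, inner_self_eq_norm_sq_to_K] at key
    have h1 : (⟪t, u⟫ : ℂ).re = (⟪u, t⟫ : ℂ).re := aux_re_symm u t
    rw [h1, div_mul_eq_mul_div, one_mul, le_div_iff₀ hba] at key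
    have h2 : (((‖u‖ : ℂ)) ^ 2).re = ‖u‖ ^ 2 := by norm_cast
    simp only [Complex.coe_algebraMap, h2] at key
    linarith
  · intro μ hμ w hEw hw
    obtain ⟨l, hl, rfl⟩ := List.mem_map.1 hμ
    obtain ⟨hla, hl2⟩ := hls l hl
    have hla' : (l : ℂ) - a ≠ 0 := by
      rw [sub_ne_zero]; exact_mod_cast hla
    have h := g.smul_mem ((l : ℂ) - a) (hR1 w)
    rw [hw] at h
    simp only [Prod.smul_mk, smul_add, smul_smul] at h
    rw [← hEw, eq_comm]
    apply hl2
    convert h using 2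
    · push_cast; field_simp; simp
    · rw [← add_smul]; congr 1; push_cast; field_simp; ring
  · intro μ hμ hlt
    have hμ0 : 0 < μ := lt_trans (by positivity) hlt
    by_contra hmem
    have hlb : a + 1 / μ ≤ b := by
      have : 1 / μ < b - a := by
        rw [div_lt_iff₀ hμ0]; rw [div_lt_iff₀ hba] at hlt; linarith
      linarith
    have hla : a < a + 1 / μ := by have : 0 < 1 / μ := by positivity
                                   linarith
    obtain ⟨S, hS1, hS2⟩ := hres (a + 1 / μ) hla hlb (by
      intro h
      apply hmem
      refine List.mem_map.2 ⟨_, h, ?_⟩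
      field_simp; ring)
    apply hμ
    have hμc : (μ : ℂ) ≠ 0 := by exact_mod_cast hμ0.ne'
    -- resolvent identities
    have hid1 : ∀ y, Ra (S y) = (μ : ℂ) • (S y - Ra y) := by
      intro y
      have h := hR2 _ _ (hS1 y)
      have h' : y + ((a + 1 / μ : ℝ) : ℂ) • S y - (a : ℂ) • S y = y + (1 / μ : ℂ) • S y := by
        push_cast; rw [add_smul]; abel
      rw [h', map_add, map_smul] at h
      have h2 : (1 / μ : ℂ) • Ra (S y) = S y - Ra y := eq_sub_of_add_eq' h
      rw [← h2, smul_smul, mul_one_div_cancel hμc, one_smul]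
    have hid2 : ∀ y, S (Ra y) = (μ : ℂ) • (S y - Ra y) := by
      intro y
      have h := hS2 _ _ (hR1 y)
      have h' : y + (a : ℂ) • Ra y - ((a + 1 / μ : ℝ) : ℂ) • Ra y = y - (1 / μ : ℂ) • Ra y := by
        push_cast; rw [add_smul]; abel
      rw [h', map_sub, map_smul] at h
      have h2 : (1 / μ : ℂ) • S (Ra y) = S y - Ra y := by
        rw [sub_eq_iff_eq_add] at h; rw [h]; abel
      rw [← h2, smul_smul, mul_one_div_cancel hμc, one_smul]
    have halg : algebraMap ℝ (H →L[ℂ] H) μ = (μ : ℂ) • 1 := by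
      ext y; simp [Algebra.algebraMap_eq_smul_one]
    rw [spectrum.mem_resolventSet_iff, halg]
    refine ⟨⟨(μ : ℂ) • 1 - Ra, (1 / μ : ℂ) • (1 + (1 / μ : ℂ) • S), ?_, ?_⟩, rfl⟩
    · ext y
      simp only [aux_mul, _root_.sub_apply,
        _root_.smul_apply, _root_.add_apply,
        one_apply_eq_self, map_add, map_smul, hid1]
      match_scalars <;> field_simp <;> ring
    · ext y
      simp only [aux_mul, _root_.sub_apply,
        _root_.smul_apply, _root_.add_apply,
        one_apply_eq_self, map_sub, map_smul, hid2]
      match_scalars <;> field_simp <;> ring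

theorem aux_lower2 (g : Submodule ℂ (H × H))
    (hsym : ∀ x y u v : H, (x, y) ∈ g → (u, v) ∈ g → (⟪y, u⟫ : ℂ) = ⟪x, v⟫)
    (E Q : H →L[ℂ] H) (hQ : ∀ x, ‖Q x‖ ≤ ‖x‖)
    (a b : ℝ) (hab : a < b)
    (hlow : ∀ u t, (u, t) ∈ g → E u = 0 →
      (b - a) * ((⟪u, t⟫ : ℂ).re - a * ‖u‖ ^ 2) ≤ ‖t - (a : ℂ) • u‖ ^ 2)
    (z σ : ℂ) (hσ : ‖σ‖ = 1) (hza : a < z.re) (hzb : z.re < b)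
    (hda : 1 < dist z (a : ℂ)) (hdb : 1 < dist z (b : ℂ)) :
    ∃ δ > 0, ∀ u t, (u, t) ∈ g → E u = 0 → δ * ‖u‖ ≤ ‖t + σ • Q u - z • u‖ := by
  set c := min (dist z (a : ℂ)) (dist z (b : ℂ)) with hc
  have hc1 : 1 < c := lt_min hda hdb
  refine ⟨c - 1, by linarith, fun u t hut hEu => ?_⟩
  have him : (⟪u, t⟫ : ℂ).im = 0 := by
    have h1 := hsym _ _ _ _ hut hut
    have h2 := aux_im_symm u t
    rw [h1] at h2
    linarith
  have hA := hlow u t hut hEu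
  have e1 := aux_normsq u t (a : ℂ) him
  have e2 := aux_normsq u t (b : ℂ) him
  have e3 := aux_normsq u t z him
  simp only [Complex.ofReal_re, Complex.ofReal_im] at e1 e2
  have hdz : ∀ r : ℝ, dist z (r : ℂ) ^ 2 = (z.re - r) ^ 2 + z.im ^ 2 := by
    intro r
    rw [Complex.dist_eq, Complex.sq_norm, Complex.normSq_apply]
    simp; ring
  have hcu : c * ‖u‖ ≤ ‖t - z • u‖ := by
    apply le_of_sq_le_sq _ (norm_nonneg _)
    rcases aux_num a b z.re (‖u‖ ^ 2) (⟪u, t⟫ : ℂ).re (‖t‖ ^ 2) hab (by nlinarith)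
      (by nlinarith [sq_nonneg ‖t - (a : ℂ) • u‖]) (by nlinarith [sq_nonneg ‖t - (b : ℂ) • u‖])
      hza hzb with h | h
    · have h1 : c ^ 2 ≤ dist z (a : ℂ) ^ 2 :=
        pow_le_pow_left₀ (by linarith) (min_le_left _ _) 2
      rw [hdz] at h1
      have := mul_le_mul_of_nonneg_right h1 (sq_nonneg ‖u‖)
      rw [mul_pow, e3]
      nlinarith
    · have h1 : c ^ 2 ≤ dist z (b : ℂ) ^ 2 :=
        pow_le_pow_left₀ (by linarith) (min_le_right _ _) 2
      rw [hdz] at h1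
      have := mul_le_mul_of_nonneg_right h1 (sq_nonneg ‖u‖)
      rw [mul_pow, e3]
      nlinarith
  have h5 : ‖t - z • u‖ ≤ ‖t + σ • Q u - z • u‖ + ‖Q u‖ := by
    have : t - z • u = (t + σ • Q u - z • u) - σ • Q u := by abel
    rw [this]
    refine (norm_sub_le _ _).trans ?_
    rw [norm_smul, hσ, one_mul]
  have := hQ u
  linarith

/-- a closed operator (given by its graph) that is bijective after a bounded perturbation has a
bounded inverse -/
theorem aux_inv (g : Submodule ℂ (H × H)) (hcl : IsClosed (g : Set (H × H)))
    (B : H →L[ℂ] H)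
    (hinj : ∀ x y, (x, y) ∈ g → y + B x = 0 → x = 0)
    (hsurj : ∀ w, ∃ x y, (x, y) ∈ g ∧ y + B x = w) :
    ∃ R : H →L[ℂ] H, (∀ w, (R w, w - B (R w)) ∈ g) ∧ ∀ x y, (x, y) ∈ g → R (y + B x) = x := by
  choose r s hrs hw using hsurj
  have hs : ∀ w, (r w, w - B (r w)) ∈ g := by
    intro w
    have := hrs w
    rwa [show s w = w - B (r w) from eq_sub_of_add_eq (hw w)] at this
  have huniq : ∀ x w, (x, w - B x) ∈ g → r w = x := by
    intro x w h
    have h2 := g.sub_mem (hs w) h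
    rw [Prod.mk_sub_mk] at h2
    have := hinj _ _ h2 (by rw [map_sub]; abel)
    exact sub_eq_zero.1 this
  let R : H →ₗ[ℂ] H :=
    { toFun := r
      map_add' := by
        intro x y
        apply huniq
        have := g.add_mem (hs x) (hs y)
        rw [Prod.mk_add_mk] at this
        convert this using 2
        rw [map_add]; abel
      map_smul' := by
        intro c x
        apply huniq
        have := g.smul_mem c (hs x)
        rw [Prod.smul_mk] at this
        rw [RingHom.id_apply, map_smul, ← smul_sub]
        exact this }
  have hR : Continuous R := by
    refine R.continuous_of_seq_closed_graph fun u x y hu hRu => ?_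
    refine (huniq y x ?_).symm
    have h2 : Filter.Tendsto (fun n => (R (u n), u n - B (R (u n)))) Filter.atTop
        (nhds (y, x - B y)) := by
      refine Filter.Tendsto.prodMk_nhds hRu (hu.sub ?_)
      exact (B.continuous.tendsto y).comp hRu
    exact hcl.mem_of_tendsto h2 (Filter.Eventually.of_forall fun n => hs (u n))
  refine ⟨⟨R, hR⟩, hs, ?_⟩
  intro x y h
  apply huniq
  simpa using h

theorem aux_surj (g : Submodule ℂ (H × H)) (hcl : IsClosed (g : Set (H × H)))
    (hmax : ∀ y w : H, (∀ u v, (u, v) ∈ g → (⟪w, u⟫ : ℂ) = ⟪y, v⟫) → (y, w) ∈ g)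
    (E Q : H →L[ℂ] H) (hEg : ∀ x y, (x, y) ∈ g → (E x, E y) ∈ g)
    (hfun : ∀ y, ((0 : H), y) ∈ g → y = 0)
    (hEsym : ∀ x y, (⟪E x, y⟫ : ℂ) = ⟪x, E y⟫) (hEE : ∀ x, E (E x) = E x)
    (hQsym : ∀ x y, (⟪Q x, y⟫ : ℂ) = ⟪x, Q y⟫)
    (hQE : ∀ x, Q (E x) = E x) (hEQ : ∀ x, E (Q x) = E x) (z : ℂ)
    (h1 : ∃ δ > 0, ∀ u t, (u, t) ∈ g → E u = 0 → δ * ‖u‖ ≤ ‖t + Complex.I • Q u - z • u‖)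
    (h2 : ∃ δ > 0, ∀ u t, (u, t) ∈ g → E u = 0 →
      δ * ‖u‖ ≤ ‖t + (-Complex.I) • Q u - (starRingEnd ℂ z) • u‖)
    (w : H) (hw : E w = 0) :
    ∃ x y, (x, y) ∈ g ∧ y + Complex.I • Q x - z • x = w := by
  obtain ⟨δ, hδ, h1⟩ := h1
  obtain ⟨δ', hδ', h2⟩ := h2
  let M : Submodule ℂ (H × H) :=
    g ⊓ LinearMap.ker (E.comp (ContinuousLinearMap.fst ℂ H H)).toLinearMap
  have hMcl : IsClosed (M : Set (H × H)) := by
    have : (M : Set (H × H)) = (g : Set (H × H)) ∩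
      (LinearMap.ker (E.comp (ContinuousLinearMap.fst ℂ H H)).toLinearMap : Set (H × H)) := rfl
    rw [this]
    exact hcl.inter (ContinuousLinearMap.isClosed_ker _)
  haveI : CompleteSpace M := hMcl.completeSpace_coe
  have hMmem : ∀ p : M, ((p : H × H).1, (p : H × H).2) ∈ g ∧ E (p : H × H).1 = 0 :=
    fun p => ⟨p.2.1, p.2.2⟩
  let B : H →L[ℂ] H := Complex.I • Q - z • 1
  have hB : ∀ x, B x = Complex.I • Q x - z • x := fun x => rfl
  let F : M →L[ℂ] H := (ContinuousLinearMap.snd ℂ H H + B.comp (ContinuousLinearMap.fst ℂ H H)).comp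
    M.subtypeL
  have hF : ∀ p : M, F p = (p : H × H).2 + Complex.I • Q (p : H × H).1 - z • (p : H × H).1 := by
    intro p
    have : F p = (p : H × H).2 + B (p : H × H).1 := rfl
    rw [this, hB]; abel
  have hbd : ∀ p : M, ‖p‖ ≤ ((1 / δ) + (1 + ‖B‖ * (1 / δ))) * ‖F p‖ := by
    intro p
    have ha := h1 _ _ (hMmem p).1 (hMmem p).2
    rw [← hF] at ha
    have hb : ‖(p : H × H).1‖ ≤ (1 / δ) * ‖F p‖ := by
      rw [div_mul_eq_mul_div, one_mul, le_div_iff₀ hδ]; linarith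
    have hc : ‖(p : H × H).2‖ ≤ ‖F p‖ + ‖B‖ * ‖(p : H × H).1‖ := by
      have : (p : H × H).2 = F p - B (p : H × H).1 := by rw [hF, hB]; abel
      calc ‖(p : H × H).2‖ = ‖F p - B (p : H × H).1‖ := by rw [← this]
        _ ≤ _ := (norm_sub_le _ _).trans (by gcongr; exact B.le_opNorm _)
    have hd : ‖B‖ * ‖(p : H × H).1‖ ≤ ‖B‖ * ((1 / δ) * ‖F p‖) := by gcongr
    have he : ‖p‖ = max ‖(p : H × H).1‖ ‖(p : H × H).2‖ := rfl
    have hf : 0 ≤ (1 / δ) * ‖F p‖ := by positivity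
    have hg : 0 ≤ ‖B‖ * ((1 / δ) * ‖F p‖) := by positivity
    have hh := norm_nonneg (F p)
    rw [he]
    refine max_le ?_ ?_ <;> nlinarith
  have hanti : AntilipschitzWith (Real.toNNReal ((1 / δ) + (1 + ‖B‖ * (1 / δ)))) F := by
    apply F.antilipschitz_of_bound
    intro p
    rw [Real.coe_toNNReal _ (by positivity)]
    exact hbd p
  have hVcl : IsClosed (Set.range F) := hanti.isClosed_range F.uniformContinuous
  let V : Submodule ℂ H := LinearMap.range F.toLinearMap
  have hVcl' : IsClosed (V : Set H) := by
    have : (V : Set H) = Set.range F := by ext x; simp [V]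
    rw [this]; exact hVcl
  haveI : CompleteSpace V := hVcl'.completeSpace_coe
  have hEV : ∀ v ∈ V, E v = 0 := by
    rintro v ⟨p, rfl⟩
    have hp := hMmem p
    have hE2 : E (p : H × H).2 = 0 := by
      have := hEg _ _ hp.1
      rw [hp.2] at this
      exact hfun _ this
    change E (F p) = 0
    rw [hF]
    simp [hE2, hEQ, hp.2]
  obtain ⟨v, hv, y0, hy0, hsum⟩ := V.exists_add_mem_mem_orthogonal w
  have hEy0 : E y0 = 0 := by
    have : y0 = w - v := by rw [hsum]; abel
    rw [this, map_sub, hw, hEV v hv, sub_zero]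
  have hmem : (y0, (starRingEnd ℂ z) • y0 + Complex.I • Q y0) ∈ g := by
    apply hmax
    intro u t hut
    have hE := hEg _ _ hut
    have hd := g.sub_mem hut hE
    rw [Prod.mk_sub_mk] at hd
    let p : M := ⟨(u - E u, t - E t), hd, by simp [hEE]⟩
    have hp := hF p
    have hin : F p ∈ V := ⟨p, rfl⟩
    have h0 : (⟪y0, F p⟫ : ℂ) = 0 := V.inner_left_of_mem_orthogonal hin hy0
    rw [hp] at h0
    have hEy : ∀ x, (⟪y0, E x⟫ : ℂ) = 0 := by
      intro x; rw [← hEsym, hEy0, inner_zero_left]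
    simp only [p, map_sub, hQE, smul_sub, inner_sub_right, inner_add_right, inner_smul_right,
      hEy, mul_zero, sub_zero] at h0
    rw [inner_add_left, inner_smul_left, inner_smul_left, hQsym]
    simp only [Complex.conj_I, Complex.conj_conj]
    linear_combination -h0
  have := h2 _ _ hmem hEy0
  have hz : (starRingEnd ℂ z) • y0 + Complex.I • Q y0 + -Complex.I • Q y0 - (starRingEnd ℂ z) • y0
    = 0 := by rw [neg_smul]; abel
  rw [hz, norm_zero] at this
  have hy00 : y0 = 0 := by
    rw [← norm_le_zero_iff]
    by_contra hcon
    push Not at hcon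
    nlinarith [mul_pos hδ' hcon]
  rw [hy00, add_zero] at hsum
  obtain ⟨p, hp⟩ := hv
  refine ⟨_, _, (hMmem p).1, ?_⟩
  rw [← hF, hsum]; exact hp

/-- **Lemma.** If `‖(I - Q)E(Δ)‖ = 0` then the `λ_j + i` are semi-simple eigenvalues of
`T + iQ` with eigenspaces `L({λ_j})`, the span of the eigenvectors is `L(Δ)`, and
`U(a,b) ⊆ ρ(T + iQ)`. -/
theorem stmt_13
    -- `T` is a semi-bounded self-adjoint operator
    (T : H →ₗ.[ℂ] H) (hsa : IsSelfAdjoint T)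
    (hsemibdd : ∃ m : ℝ, ∀ u : T.domain, m * ‖(u : H)‖ ^ 2 ≤ (⟪(u : H), T u⟫ : ℂ).re)
    -- `a, b ∈ ρ(T)`, `Δ = [a,b]`, and `Δ ∩ σ(T) = {λ_1,…,λ_d} ⊆ σ_dis(T)`
    (a b : ℝ) (hab : a < b)
    (ha : (a : ℂ) ∈ pmResolventSet T) (hb : (b : ℂ) ∈ pmResolventSet T)
    (d : ℕ) (lam : Fin d → ℝ)
    (hΔ : (fun x : ℝ => (x : ℂ)) '' Set.Icc a b ∩ pmSpectrum T
      = Set.range fun j => ((lam j : ℂ)))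
    (hdis : ∀ j, ((lam j : ℂ)) ∈ pmDiscSpectrum T)
    -- the eigenvalues are repeated according to multiplicity
    (hmult : ∀ j, Module.finrank ℂ (pmEigenspace T ((lam j : ℂ)))
      = (Finset.univ.filter fun i => lam i = lam j).card)
    -- `E = E(Δ)` is the spectral projection of `T` for `Δ`
    (E : H →L[ℂ] H) (hEsa : IsSelfAdjoint E) (hEidem : IsIdempotentElem E)
    (hErange : LinearMap.range E.toLinearMap = ⨆ j, pmEigenspace T ((lam j : ℂ)))
    -- `Q` is an orthogonal projection
    (Q : H →L[ℂ] H) (hQsa : IsSelfAdjoint Q) (hQidem : IsIdempotentElem Q)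
    -- `‖(I - Q)E(Δ)‖ = 0`
    (hε : ‖(1 - Q) * E‖ = 0) :
    -- `λ_j + i` is an eigenvalue of `T + iQ` whose eigenspace is `L({λ_j})`
    (∀ j, pertEigenspace T (Complex.I • Q) ((lam j : ℂ) + Complex.I)
        = pmEigenspace T ((lam j : ℂ)) ∧
      pertEigenspace T (Complex.I • Q) ((lam j : ℂ) + Complex.I) ≠ ⊥) ∧
    -- each `λ_j + i` is semi-simple: there are no generalised eigenvectors
    (∀ j, ∀ ψ : T.domain,
      T ψ + Complex.I • Q (ψ : H) - ((lam j : ℂ) + Complex.I) • (ψ : H)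
          ∈ pertEigenspace T (Complex.I • Q) ((lam j : ℂ) + Complex.I) →
        (ψ : H) ∈ pertEigenspace T (Complex.I • Q) ((lam j : ℂ) + Complex.I)) ∧
    -- the span of the eigenvectors is exactly `L(Δ)`
    (⨆ j, pertEigenspace T (Complex.I • Q) ((lam j : ℂ) + Complex.I))
      = (⨆ j, pmEigenspace T ((lam j : ℂ))) ∧
    -- `U(a,b) ⊆ ρ(T + iQ)`
    Uab a b lam ⊆ pertResolventSet T (Complex.I • Q) := by
  have hdense := hsa.dense_domain
  have hadj : T.adjoint = T := hsa
  have hform : T.IsFormalAdjoint T := by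
    have := LinearPMap.adjoint_isFormalAdjoint hdense
    rwa [hadj] at this
  have hcl : IsClosed (T.graph : Set (H × H)) := hsa.isClosed
  -- facts about the graph
  have hgm : ∀ x (hx : x ∈ T.domain), (x, T ⟨x, hx⟩) ∈ T.graph := fun x hx =>
    T.mem_graph ⟨x, hx⟩
  have hgx : ∀ x y, (x, y) ∈ T.graph → ∃ hx : x ∈ T.domain, T ⟨x, hx⟩ = y := by
    intro x y h
    obtain ⟨u, hu1, hu2⟩ := (LinearPMap.mem_graph_iff T).1 h
    subst hu1
    exact ⟨u.2, hu2⟩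
  have hsym : ∀ x y u v : H, (x, y) ∈ T.graph → (u, v) ∈ T.graph → (⟪y, u⟫ : ℂ) = ⟪x, v⟫ := by
    intro x y u v h1 h2
    obtain ⟨hx, rfl⟩ := hgx _ _ h1
    obtain ⟨hu, rfl⟩ := hgx _ _ h2
    exact hform ⟨x, hx⟩ ⟨u, hu⟩
  have hfun : ∀ y, ((0 : H), y) ∈ T.graph → y = 0 := by
    intro y h
    exact LinearPMap.graph_fst_eq_zero_snd T h rfl
  have hmax : ∀ y w : H, (∀ u v, (u, v) ∈ T.graph → (⟪w, u⟫ : ℂ) = ⟪y, v⟫) →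
      (y, w) ∈ T.graph := by
    intro y w h
    have h' : ∀ x : T.domain, (⟪w, (x : H)⟫ : ℂ) = ⟪y, T x⟫ := fun x => h _ _ (T.mem_graph x)
    have hy : y ∈ T.adjoint.domain := LinearPMap.mem_adjoint_domain_of_exists y ⟨w, h'⟩
    have he := LinearPMap.adjoint_apply_eq hdense ⟨y, hy⟩ h'
    have : (y, w) ∈ T.adjoint.graph := by
      rw [← he]; exact T.adjoint.mem_graph ⟨y, hy⟩
    rwa [hadj] at this
  have heig : ∀ (l : ℂ) x, x ∈ pmEigenspace T l ↔ (x, l • x) ∈ T.graph := by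
    intro l x
    constructor
    · rintro ⟨hx, h⟩
      rw [← h]; exact hgm x hx
    · intro h
      exact hgx _ _ h
  have hpeig : ∀ (l : ℂ) x, x ∈ pertEigenspace T (Complex.I • Q) l ↔
      (x, l • x - Complex.I • Q x) ∈ T.graph := by
    intro l x
    constructor
    · rintro ⟨hx, h⟩
      rw [← h]
      have : T ⟨x, hx⟩ + (Complex.I • Q) x - Complex.I • Q x = T ⟨x, hx⟩ :=
        add_sub_cancel_right _ _
      rw [this]; exact hgm x hx
    · intro h
      obtain ⟨hx, h⟩ := hgx _ _ h
      refine ⟨hx, ?_⟩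
      rw [h]
      exact sub_add_cancel _ _
  -- the projections
  have hEsym : ∀ x y, (⟪E x, y⟫ : ℂ) = ⟪x, E y⟫ :=
    (ContinuousLinearMap.isSelfAdjoint_iff_isSymmetric.1 hEsa)
  have hQsym : ∀ x y, (⟪Q x, y⟫ : ℂ) = ⟪x, Q y⟫ :=
    (ContinuousLinearMap.isSelfAdjoint_iff_isSymmetric.1 hQsa)
  have hEE : ∀ x, E (E x) = E x := fun x => congrArg (fun A : H →L[ℂ] H => A x) hEidem.eq
  have hQQ : ∀ x, Q (Q x) = Q x := fun x => congrArg (fun A : H →L[ℂ] H => A x) hQidem.eq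
  have hQE : ∀ x, Q (E x) = E x := by
    intro x
    have h := congrArg (fun A : H →L[ℂ] H => A x) (norm_eq_zero.1 hε)
    have h' : E x - Q (E x) = 0 := h
    exact (sub_eq_zero.1 h').symm
  have hEQ : ∀ x, E (Q x) = E x := by
    intro x
    apply ext_inner_right ℂ
    intro y
    rw [hEsym, hQsym, hQE, ← hEsym]
  have hQn : ∀ x, ‖Q x‖ ≤ ‖x‖ := by
    intro x
    have h : (‖Q x‖ : ℝ) ^ 2 ≤ ‖x‖ * ‖Q x‖ := by
      have h1 : (⟪Q x, Q x⟫ : ℂ) = ⟪x, Q x⟫ := by rw [hQsym, hQQ]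
      have h2 := norm_inner_le_norm (𝕜 := ℂ) x (Q x)
      rw [← h1, inner_self_eq_norm_sq_to_K] at h2
      simpa using h2
    by_contra hcon
    push Not at hcon
    nlinarith [norm_nonneg x, norm_nonneg (Q x)]
  have hELmem : ∀ x, E x ∈ ⨆ j, pmEigenspace T ((lam j : ℂ)) := by
    intro x; rw [← hErange]; exact ⟨x, rfl⟩
  have hLE : ∀ x, x ∈ (⨆ j, pmEigenspace T ((lam j : ℂ))) → E x = x := by
    intro x hx
    rw [← hErange] at hx
    obtain ⟨y, rfl⟩ := hx
    exact hEE y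
  have heigE : ∀ j x, (x, (lam j : ℂ) • x) ∈ T.graph → E x = x := fun j x h =>
    hLE x (le_iSup (fun j => pmEigenspace T ((lam j : ℂ))) j ((heig _ _).2 h))
  have hTL : ∀ x, x ∈ (⨆ j, pmEigenspace T ((lam j : ℂ))) →
      ∃ y, (x, y) ∈ T.graph ∧ E y = y := by
    intro x hx
    induction hx using Submodule.iSup_induction' with
    | mem j x hx =>
      have h := (heig _ _).1 hx
      exact ⟨_, h, by rw [map_smul, heigE j x h]⟩
    | zero => exact ⟨0, T.graph.zero_mem, map_zero _⟩
    | add x y _ _ hx hy =>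
      obtain ⟨u, hu, hu'⟩ := hx
      obtain ⟨v, hv, hv'⟩ := hy
      exact ⟨u + v, T.graph.add_mem hu hv, by rw [map_add, hu', hv']⟩
  have hEg : ∀ x y, (x, y) ∈ T.graph → (E x, E y) ∈ T.graph := by
    intro x y hxy
    obtain ⟨t, ht, htE⟩ := hTL _ (hELmem x)
    have : E y = t := by
      apply ext_inner_right ℂ
      intro v
      obtain ⟨s, hs, hsE⟩ := hTL _ (hELmem v)
      rw [hEsym, hsym _ _ _ _ hxy hs, ← hsE, ← hEsym, ← hsym _ _ _ _ ht hs, ← hEsym, htE]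
    rw [this]; exact ht
  -- resolvents
  have hresg : ∀ z : ℂ, z ∈ pmResolventSet T → ∃ R : H →L[ℂ] H,
      (∀ y, (R y, y + z • R y) ∈ T.graph) ∧
        ∀ x y, (x, y) ∈ T.graph → R (y - z • x) = x := by
    rintro z ⟨R, h1, h2⟩
    refine ⟨R, fun y => ?_, fun x y hxy => ?_⟩
    · obtain ⟨hy, h⟩ := h1 y
      have := hgm _ hy
      rwa [sub_eq_iff_eq_add.1 h] at this
    · obtain ⟨hx, rfl⟩ := hgx _ _ hxy
      exact h2 ⟨x, hx⟩
  have hlamI : ∀ j, a < lam j ∧ lam j < b := by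
    intro j
    have hm : ((lam j : ℂ)) ∈ (fun x : ℝ => (x : ℂ)) '' Set.Icc a b ∩ pmSpectrum T := by
      rw [hΔ]; exact ⟨j, rfl⟩
    obtain ⟨⟨x, hx, hxe⟩, hs⟩ := hm
    have hxl : x = lam j := Complex.ofReal_injective hxe
    subst hxl
    refine ⟨lt_of_le_of_ne hx.1 ?_, lt_of_le_of_ne hx.2 ?_⟩
    · intro h; rw [← h] at hs; exact hs ha
    · intro h; rw [h] at hs; exact hs hb
  obtain ⟨Ra, hR1, hR2⟩ := hresg _ ha
  have hlow : ∀ u t, (u, t) ∈ T.graph → E u = 0 →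
      (b - a) * ((⟪u, t⟫ : ℂ).re - a * ‖u‖ ^ 2) ≤ ‖t - (a : ℂ) • u‖ ^ 2 := by
    intro u t hut hEu
    refine aux_lower T.graph hsym E hEg hfun a b hab Ra hR1 hR2 (List.ofFn lam) ?_ ?_ u t hut hEu
    · intro l hl
      obtain ⟨j, rfl⟩ := (List.mem_ofFn' _ _).1 hl
      exact ⟨(hlamI j).1.ne', heigE j⟩
    · intro l hal hlb hl
      apply hresg
      by_contra hcon
      have hm : (l : ℂ) ∈ (fun x : ℝ => (x : ℂ)) '' Set.Icc a b ∩ pmSpectrum T :=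
        ⟨⟨l, ⟨hal.le, hlb⟩, rfl⟩, hcon⟩
      rw [hΔ] at hm
      obtain ⟨j, hj⟩ := hm
      apply hl
      refine (List.mem_ofFn' _ _).2 ⟨j, ?_⟩
      exact Complex.ofReal_injective hj
  have hlow2 := aux_lower2 T.graph hsym E Q hQn a b hab hlow
  -- consequence: images in `L` come from `L`
  have hback : ∀ z : ℂ, a < z.re → z.re < b → 1 < dist z (a : ℂ) → 1 < dist z (b : ℂ) →
      ∀ x y, (x, y) ∈ T.graph →
        E (y + Complex.I • Q x - z • x) = y + Complex.I • Q x - z • x → E x = x := by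
    intro z h1 h2 h3 h4 x y hxy hE
    obtain ⟨δ, hδ, h⟩ := hlow2 z Complex.I Complex.norm_I h1 h2 h3 h4
    have hd := T.graph.sub_mem hxy (hEg _ _ hxy)
    rw [Prod.mk_sub_mk] at hd
    have h5 := h _ _ hd (by rw [map_sub, hEE, sub_self])
    have h6 : y - E y + Complex.I • Q (x - E x) - z • (x - E x) = 0 := by
      rw [map_sub, map_add, map_smul, map_smul, hEQ] at hE
      rw [map_sub, hQE, smul_sub, smul_sub]
      have h7 := sub_eq_zero.2 hE.symm
      rw [← h7]; abel
    rw [h6, norm_zero] at h5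
    have h8 : ‖x - E x‖ = 0 := by
      by_contra hcon
      have := lt_of_le_of_ne (norm_nonneg (x - E x)) (Ne.symm hcon)
      nlinarith [mul_pos hδ this]
    exact (sub_eq_zero.1 (norm_eq_zero.1 h8)).symm
  have hdI : ∀ j (r : ℝ), lam j ≠ r → 1 < dist ((lam j : ℂ) + Complex.I) (r : ℂ) := by
    intro j r hr
    rw [Complex.dist_eq]
    have h1 : ‖(lam j : ℂ) + Complex.I - r‖ ^ 2 = (lam j - r) ^ 2 + 1 := by
      rw [Complex.sq_norm, Complex.normSq_apply]; simp; ring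
    have h2 : 0 < (lam j - r) ^ 2 := by
      have := sub_ne_zero.2 hr
      positivity
    nlinarith [norm_nonneg ((lam j : ℂ) + Complex.I - r)]
  have hbackj : ∀ j x y, (x, y) ∈ T.graph →
      E (y + Complex.I • Q x - ((lam j : ℂ) + Complex.I) • x)
        = y + Complex.I • Q x - ((lam j : ℂ) + Complex.I) • x → E x = x := by
    intro j
    refine hback _ ?_ ?_ (hdI j a (hlamI j).1.ne') (hdI j b (hlamI j).2.ne)
    · simpa using (hlamI j).1
    · simpa using (hlamI j).2
  have hQofE : ∀ x, E x = x → Q x = x := by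
    intro x hx
    rw [← hx, hQE]
  have hpart1 : ∀ j, pertEigenspace T (Complex.I • Q) ((lam j : ℂ) + Complex.I)
        = pmEigenspace T ((lam j : ℂ)) := by
    intro j
    ext x
    rw [hpeig, heig]
    constructor
    · intro h
      have hx : E x = x := by
        apply hbackj j _ _ h
        rw [sub_add_cancel, sub_self, map_zero]
      rwa [hQofE x hx, ← sub_smul, add_sub_cancel_right] at h
    · intro h
      rwa [hQofE x (heigE j x h), ← sub_smul, add_sub_cancel_right]
  refine ⟨fun j => ⟨hpart1 j, ?_⟩, ?_, ?_, ?_⟩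
  · rw [hpart1 j]; exact (hdis j).2.2.1
  · intro j ψ hψ
    rw [hpart1 j] at hψ ⊢
    have hg := T.mem_graph ψ
    have hψE : E (ψ : H) = ψ := by
      apply hbackj j _ _ hg
      exact heigE j _ ((heig _ _).1 hψ)
    have he : T ψ + Complex.I • Q (ψ : H) - ((lam j : ℂ) + Complex.I) • (ψ : H)
        = T ψ - (lam j : ℂ) • (ψ : H) := by
      rw [hQofE _ hψE, add_smul]; abel
    rw [he, heig] at hψ
    set w := T ψ - (lam j : ℂ) • (ψ : H) with hw
    have h1 := hsym _ _ _ _ hg hψ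
    have h2 : (⟪w, w⟫ : ℂ) = 0 := by
      conv_lhs => rw [hw]
      rw [inner_sub_left, h1, inner_smul_left, inner_smul_right, Complex.conj_ofReal, sub_self]
    have h3 : w = 0 := inner_self_eq_zero.1 h2
    rw [heig, ← sub_eq_zero.1 h3]
    exact hg
  · exact iSup_congr hpart1
  · rintro z ⟨hz1, hz2, hz3, hz4, hz5⟩
    let B : H →L[ℂ] H := Complex.I • Q - z • 1
    have hB : ∀ x, B x = Complex.I • Q x - z • x := fun x => rfl
    have hinj : ∀ x y, (x, y) ∈ T.graph → y + B x = 0 → x = 0 := by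
      intro x y hxy h
      rw [hB, ← add_sub_assoc] at h
      have hx : E x = x := by
        apply hback z hz1 hz2 hz3 hz4 _ _ hxy
        rw [h, map_zero]
      have hy : y = (z - Complex.I) • x := by
        rw [hQofE x hx] at h
        rw [sub_smul, ← sub_eq_zero, ← h]; abel
      have horth : ∀ v, v ∈ (⨆ j, pmEigenspace T ((lam j : ℂ))) → (⟪v, x⟫ : ℂ) = 0 := by
        intro v hv
        induction hv using Submodule.iSup_induction' with
        | mem j v hv =>
          have h1 := hsym _ _ _ _ ((heig _ _).1 hv) hxy
          rw [hy, inner_smul_left, inner_smul_right, Complex.conj_ofReal] at h1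
          have h2 : ((lam j : ℂ) + Complex.I - z) * (⟪v, x⟫ : ℂ) = 0 := by
            linear_combination h1
          rcases mul_eq_zero.1 h2 with h3 | h3
          · exact absurd (sub_eq_zero.1 h3).symm (hz5 j)
          · exact h3
        | zero => exact inner_zero_left _
        | add u v _ _ hu hv => rw [inner_add_left, hu, hv, add_zero]
      have := horth (E x) (hELmem x)
      rw [hx] at this
      exact inner_self_eq_zero.1 this
    have hsurjL : ∀ w, w ∈ (⨆ j, pmEigenspace T ((lam j : ℂ))) →
        ∃ x y, (x, y) ∈ T.graph ∧ y + B x = w := by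
      intro w hw
      induction hw using Submodule.iSup_induction' with
      | mem j w hw =>
        have h1 := (heig _ _).1 hw
        have hne : (lam j : ℂ) + Complex.I - z ≠ 0 := fun h => hz5 j (sub_eq_zero.1 h).symm
        set c := ((lam j : ℂ) + Complex.I - z)⁻¹ with hc
        refine ⟨c • w, c • ((lam j : ℂ) • w), T.graph.smul_mem c h1, ?_⟩
        rw [map_smul, hB, hQofE w (heigE j w h1), ← smul_add, ← sub_smul, ← add_smul, smul_smul,
          ← add_sub_assoc, hc, inv_mul_cancel₀ hne, one_smul]
      | zero => exact ⟨0, 0, T.graph.zero_mem, by simp⟩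
      | add u v _ _ hu hv =>
        obtain ⟨x, y, h1, h2⟩ := hu
        obtain ⟨x', y', h1', h2'⟩ := hv
        refine ⟨x + x', y + y', T.graph.add_mem h1 h1', ?_⟩
        rw [map_add, ← h2, ← h2']; abel
    have hsurj : ∀ w, ∃ x y, (x, y) ∈ T.graph ∧ y + B x = w := by
      intro w
      have hdc : ∀ r : ℝ, dist (starRingEnd ℂ z) (r : ℂ) = dist z (r : ℂ) := by
        intro r
        rw [← Complex.dist_conj_conj z, Complex.conj_ofReal]
      obtain ⟨x, y, h1, h2⟩ := aux_surj T.graph hcl hmax E Q hEg hfun hEsym hEE hQsym hQE hEQ z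
        (hlow2 z Complex.I Complex.norm_I hz1 hz2 hz3 hz4)
        (hlow2 (starRingEnd ℂ z) (-Complex.I) (by simp) (by simpa using hz1) (by simpa using hz2)
          (by rwa [hdc]) (by rwa [hdc])) (w - E w) (by rw [map_sub, hEE, sub_self])
      obtain ⟨x', y', h1', h2'⟩ := hsurjL (E w) (hELmem w)
      refine ⟨x + x', y + y', T.graph.add_mem h1 h1', ?_⟩
      rw [add_sub_assoc, ← hB] at h2
      rw [map_add, show y + y' + (B x + B x') = (y + B x) + (y' + B x') by abel, h2, h2']
      abel
    obtain ⟨R, hRa, hRb⟩ := aux_inv T.graph hcl B hinj hsurj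
    refine ⟨R, fun y => ?_, fun x => ?_⟩
    · obtain ⟨hy, h⟩ := hgx _ _ (hRa y)
      refine ⟨hy, ?_⟩
      rw [h, hB]
      change y - (Complex.I • Q (R y) - z • R y) + Complex.I • Q (R y) - z • R y = y
      abel
    · have h := hRb _ _ (T.mem_graph x)
      rw [hB, ← add_sub_assoc] at h
      exact h
end
end

section
/- Let T be a bounded self-adjoint operator, let E_n be the spectral measure of the compression P_n T|_{L_n}, and set Q_n = E_n(Δ)P_n. Then Q_n → E(Δ) strongly, and ‖(I − Q_n)E(Δ)‖ = O(δ(L(Δ), L_n)) as n → ∞. -/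
open scoped ComplexInnerProductSpace
open Filter

noncomputable section

variable {H : Type*} [NormedAddCommGroup H] [InnerProductSpace ℂ H] [CompleteSpace H]

/-- The discrete spectrum of a bounded operator: isolated eigenvalues of finite
multiplicity. -/
def discSpectrum (T : H →L[ℂ] H) : Set ℂ :=
  {z | z ∈ spectrum ℂ T ∧ (∃ ε > 0, ∀ w ∈ spectrum ℂ T, w ≠ z → ε ≤ dist w z) ∧
    Module.End.eigenspace (T : H →ₗ[ℂ] H) z ≠ ⊥ ∧
    FiniteDimensional ℂ (Module.End.eigenspace (T : H →ₗ[ℂ] H) z)}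

/-- The (one-sided) gap `δ(M,N)` between two subspaces of `H`. -/
def gapDelta (M N : Set H) : ℝ :=
  sSup ((fun x => Metric.infDist x N) '' {x ∈ M | ‖x‖ = 1})

/-- The spectral subspace of the compression `T_n = P_n T|_{L_n}` associated with the
interval `[a,b]`, i.e. the range of `E_n([a,b])`, regarded as a subspace of `H`. -/
def galSpectralSubspace (a b : ℝ) (L : ℕ → Submodule ℂ H)
    (Tn : ∀ n, L n →ₗ[ℂ] L n) (n : ℕ) : Submodule ℂ H :=
  Submodule.map (L n).subtype
    (⨆ (μ : ℝ) (_ : μ ∈ Set.Icc a b),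
      Module.End.eigenspace (Tn n : Module.End ℂ (L n)) (μ : ℂ))

theorem aux_cont {σ : Set ℝ} {a b : ℝ} (hσ : IsClosed σ) (ha : a ∉ σ) (hb : b ∉ σ)
    (hfin : (Set.Icc a b ∩ σ).Finite) (h : ℝ → ℝ) (hh : ContinuousOn h (σ \ Set.Ioo a b)) :
    ContinuousOn h σ := by
  have h1 : ContinuousOn h (Set.Icc a b ∩ σ) := hfin.continuousOn h
  have := h1.union_of_isClosed hh (isClosed_Icc.inter hσ) (hσ.sdiff isOpen_Ioo)
  refine this.mono ?_
  intro x hx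
  by_cases hx' : x ∈ Set.Icc a b
  · exact Or.inl ⟨hx', hx⟩
  · exact Or.inr ⟨hx, fun h => hx' (Set.Ioo_subset_Icc_self h)⟩

theorem aux_spectral {H : Type*} [NormedAddCommGroup H] [InnerProductSpace ℂ H] [CompleteSpace H]
    (T : H →L[ℂ] H) (hsa : IsSelfAdjoint T) (a b : ℝ) (hab : a < b)
    (ha : a ∉ spectrum ℝ T) (hb : b ∉ spectrum ℝ T) (S : Finset ℝ)
    (hS : Set.Icc a b ∩ spectrum ℝ T = (S : Set ℝ)) :
    ∃ (F G : H →L[ℂ] H) (p : ℝ → H →L[ℂ] H), IsSelfAdjoint F ∧ F = ∑ l ∈ S, p l ∧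
      (∀ l ∈ S, ∀ x, T (p l x) = (l : ℂ) • p l x) ∧
      (∀ l ∈ S, ∀ u, T u = (l : ℂ) • u → F u = u) ∧ ‖G‖ < 1 ∧
      (∀ x, T (G x) - (((a + b) / 2 : ℝ) : ℂ) • G x = (((b - a) / 2 : ℝ) : ℂ) • (x - F x)) ∧
      (∀ x, F (G x) = 0) := by
  classical
  have hcl : IsClosed (spectrum ℝ T) := spectrum.isClosed (𝕜 := ℝ) T
  have hfin : (Set.Icc a b ∩ spectrum ℝ T).Finite := by rw [hS]; exact S.finite_toSet
  have hout : ∀ t ∈ spectrum ℝ T \ Set.Ioo a b, t < a ∨ b < t := by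
    rintro t ⟨ht, ht'⟩
    by_contra hc
    push Not at hc
    exact ht' ⟨lt_of_le_of_ne hc.1 (fun h => ha (h ▸ ht)), lt_of_le_of_ne hc.2 (fun h => hb (h ▸ ht))⟩
  have hin : ∀ l ∈ S, a < l ∧ l < b := by
    intro l hl
    have : l ∈ Set.Icc a b ∩ spectrum ℝ T := by rw [hS]; exact hl
    exact ⟨lt_of_le_of_ne this.1.1 (fun h => ha (h ▸ this.2)),
      lt_of_le_of_ne this.1.2 (fun h => hb (h ▸ this.2))⟩
  have hSin : ∀ t ∈ spectrum ℝ T, t ∈ Set.Icc a b → t ∈ S := by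
    intro t ht ht'
    have : t ∈ (S : Set ℝ) := by rw [← hS]; exact ⟨ht', ht⟩
    exact this
  have hcont := aux_cont hcl ha hb hfin
  have hId : cfc (fun t : ℝ => t) T = T := cfc_id' ℝ T
  have hlin : ∀ l : ℝ, cfc (fun t : ℝ => t - l) T = T - algebraMap ℝ (H →L[ℂ] H) l := by
    intro l
    rw [cfc_sub (fun t : ℝ => t) (fun _ => l) T, hId, cfc_const l T]
  have happ : ∀ (l : ℝ) (x : H), (T - algebraMap ℝ (H →L[ℂ] H) l) x = T x - (l : ℂ) • x := by
    intro l x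
    rw [Algebra.algebraMap_eq_smul_one]
    simp
  have hmul : ∀ (A B : H →L[ℂ] H) (x : H), (A * B) x = A (B x) := fun _ _ _ => rfl
  -- the functions
  let f : ℝ → ℝ := fun t => if t ∈ Set.Icc a b then 1 else 0
  let g : ℝ → ℝ := fun t => if t ∈ Set.Icc a b then 0 else ((b - a) / 2) / (t - (a + b) / 2)
  let q : ℝ → ℝ → ℝ := fun l t => if t = l then 1 else 0
  have hf : ContinuousOn f (spectrum ℝ T) := by
    refine hcont f (ContinuousOn.congr (f := fun _ => 0) continuousOn_const ?_)
    intro t ht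
    have := hout t ht
    simp only [f]
    rw [if_neg]
    rintro ⟨h1, h2⟩
    rcases this with h | h <;> linarith
  have hg : ContinuousOn g (spectrum ℝ T) := by
    refine hcont g (ContinuousOn.congr (f := fun t => ((b - a) / 2) / (t - (a + b) / 2)) ?_ ?_)
    · refine ContinuousOn.div continuousOn_const (by fun_prop) ?_
      intro t ht h0
      rcases hout t ht with h | h <;> linarith
    · intro t ht
      have := hout t ht
      simp only [g]
      rw [if_neg]
      rintro ⟨h1, h2⟩
      rcases this with h | h <;> linarith
  have hq : ∀ l ∈ S, ContinuousOn (q l) (spectrum ℝ T) := by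
    intro l hl
    refine hcont _ (ContinuousOn.congr (f := fun _ => 0) continuousOn_const ?_)
    intro t ht
    have := hout t ht
    have h2 := hin l hl
    simp only [q]
    rw [if_neg]
    rintro rfl
    rcases this with h | h <;> linarith
  refine ⟨cfc f T, cfc g T, fun l => cfc (q l) T, cfc_predicate f T, ?_, ?_, ?_, ?_, ?_, ?_⟩
  · rw [← cfc_sum q T S hq]
    apply cfc_congr
    intro t ht
    simp only [f, q, Finset.sum_apply]
    rw [Finset.sum_ite_eq]
    by_cases h : t ∈ Set.Icc a b
    · rw [if_pos h, if_pos (hSin t ht h)]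
    · rw [if_neg h, if_neg]
      intro h'
      exact h ⟨(hin t h').1.le, (hin t h').2.le⟩
  · intro l hl x
    have h1 : cfc (fun t : ℝ => (t - l) * q l t) T = 0 := by
      rw [← cfc_zero ℝ T]
      apply cfc_congr
      intro t ht
      simp only [q]
      split_ifs with h
      · simp [h]
      · simp
    rw [cfc_mul (fun t : ℝ => t - l) (q l) T (by fun_prop) (hq l hl), hlin] at h1
    have h2 := congrArg (fun A : H →L[ℂ] H => A x) h1
    simp only [hmul, happ] at h2
    exact sub_eq_zero.mp h2
  · intro l hl u hu
    have hl' := hin l hl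
    let h : ℝ → ℝ := fun t => if t ∈ Set.Icc a b then 0 else (t - l)⁻¹
    have hh : ContinuousOn h (spectrum ℝ T) := by
      refine hcont h (ContinuousOn.congr (f := fun t => (t - l)⁻¹) ?_ ?_)
      · refine ContinuousOn.inv₀ (by fun_prop) ?_
        intro t ht h0
        rcases hout t ht with h | h <;> linarith
      · intro t ht
        have := hout t ht
        simp only [h]
        rw [if_neg]
        rintro ⟨h1, h2⟩
        rcases this with h | h <;> linarith
    have h1 : cfc (fun t : ℝ => h t * (t - l)) T = cfc (fun t => 1 - f t) T := by
      apply cfc_congr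
      intro t ht
      simp only [h, f]
      split_ifs with h'
      · simp
      · have : t - l ≠ 0 := by
          intro h0
          apply h'
          exact ⟨by linarith, by linarith⟩
        simp [this]
    rw [cfc_mul h (fun t : ℝ => t - l) T hh (by fun_prop), hlin,
      cfc_sub (fun _ => 1) f T (by fun_prop) hf, cfc_const_one ℝ T] at h1
    have h2 := congrArg (fun A : H →L[ℂ] H => A u) h1
    simp only [hmul, happ, hu, sub_self, map_zero] at h2
    simp only [sub_apply, one_apply_eq_self] at h2
    exact (sub_eq_zero.mp h2.symm).symm
  · apply norm_cfc_lt one_pos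
    intro t ht
    simp only [g]
    split_ifs with h
    · simp
    · have hd : t < a ∨ b < t := hout t ⟨ht, fun h' => h (Set.Ioo_subset_Icc_self h')⟩
      rw [norm_div, Real.norm_eq_abs, Real.norm_eq_abs, abs_of_pos (by linarith : 0 < (b-a)/2)]
      rcases hd with hd | hd
      · rw [abs_of_neg (by linarith), div_lt_one (by linarith)]; linarith
      · rw [abs_of_pos (by linarith), div_lt_one (by linarith)]; linarith
  · intro x
    have h1 : cfc (fun t : ℝ => (t - (a + b) / 2) * g t) T
        = cfc (fun t => ((b - a) / 2) * (1 - f t)) T := by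
      apply cfc_congr
      intro t ht
      simp only [g, f]
      split_ifs with h'
      · simp
      · have : t - (a + b) / 2 ≠ 0 := by
          intro h0
          apply h'
          exact ⟨by linarith, by linarith⟩
        rw [sub_zero, mul_one, mul_div_cancel₀ _ this]
    rw [cfc_mul (fun t : ℝ => t - (a + b) / 2) g T (by fun_prop) hg, hlin,
      cfc_const_mul ((b - a) / 2) (fun t => 1 - f t) T (continuousOn_const.sub hf),
      cfc_sub (fun _ => 1) f T (by fun_prop) hf, cfc_const_one ℝ T] at h1
    have h2 := congrArg (fun A : H →L[ℂ] H => A x) h1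
    simp only [hmul, happ] at h2
    simp only [sub_apply, one_apply_eq_self, smul_apply] at h2
    rw [h2, Complex.coe_smul]
  · intro x
    have h1 : cfc (fun t : ℝ => f t * g t) T = 0 := by
      rw [← cfc_zero ℝ T]
      apply cfc_congr
      intro t ht
      simp only [f, g]
      split_ifs with h
      · simp
      · simp
    rw [cfc_mul f g T hf hg] at h1
    have h2 := congrArg (fun A : H →L[ℂ] H => A x) h1
    simpa using h2

theorem aux_fin {V : Type*} [NormedAddCommGroup V] [InnerProductSpace ℂ V] [FiniteDimensional ℂ V]
    (A : V →ₗ[ℂ] V) (hA : A.IsSymmetric) (a b : ℝ) (hab : a < b) (W : Submodule ℂ V)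
    (hW : W = ⨆ (μ : ℝ) (_ : μ ∈ Set.Icc a b), Module.End.eigenspace (A : Module.End ℂ V) (μ : ℂ))
    (p : V) :
    ∃ w ∈ W, ∃ z : V, p = w + z ∧ (∀ y ∈ W, ⟪y, z⟫ = 0) ∧
      (A w - (((a + b) / 2 : ℝ) : ℂ) • w ∈ W) ∧
      (∀ y ∈ W, ⟪y, A z - (((a + b) / 2 : ℝ) : ℂ) • z⟫ = 0) ∧
      ‖A w - (((a + b) / 2 : ℝ) : ℂ) • w‖ ≤ (b - a) / 2 * ‖w‖ ∧
      ∀ l c : ℝ, 0 ≤ c → c ≤ l - a → c ≤ b - l → c * ‖z‖ ≤ ‖A p - (l : ℂ) • p‖ := by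
  have hinv : ∀ w ∈ W, A w ∈ W := by
    have : W ≤ W.comap A := by
      conv_lhs => rw [hW]
      refine iSup₂_le ?_
      intro μ hμ v hv
      rw [Submodule.mem_comap, Module.End.mem_eigenspace_iff.mp hv]
      refine W.smul_mem _ ?_
      rw [hW]
      exact (le_iSup₂ (f := fun (μ : ℝ) (_ : μ ∈ Set.Icc a b) =>
        Module.End.eigenspace (A : Module.End ℂ V) (μ : ℂ)) μ hμ) hv
    exact this
  let e := hA.eigenvectorBasis rfl
  let μ := hA.eigenvalues rfl
  have he : ∀ i, A (e i) = (μ i : ℂ) • e i := fun i => hA.apply_eigenvectorBasis rfl i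
  have hco : ∀ i v, ⟪e i, A v⟫ = (μ i : ℂ) * ⟪e i, v⟫ := by
    intro i v
    rw [← hA (e i) v, he, inner_smul_left]
    simp
  have hcol : ∀ i v (l : ℝ), ⟪e i, A v - (l : ℂ) • v⟫ = ((μ i - l : ℝ) : ℂ) * ⟪e i, v⟫ := by
    intro i v l
    rw [inner_sub_right, hco, inner_smul_right]
    push_cast
    ring
  have hin : ∀ i, μ i ∈ Set.Icc a b → e i ∈ W := by
    intro i hi
    rw [hW]
    exact (le_iSup₂ (f := fun (μ : ℝ) (_ : μ ∈ Set.Icc a b) =>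
        Module.End.eigenspace (A : Module.End ℂ V) (μ : ℂ)) (μ i) hi)
        (Module.End.mem_eigenspace_iff.mpr (he i))
  have hout : ∀ i, μ i ∉ Set.Icc a b → ∀ w ∈ W, ⟪e i, w⟫ = 0 := by
    intro i hi
    have : W ≤ (ℂ ∙ e i)ᗮ := by
      rw [hW]
      refine iSup₂_le ?_
      intro ν hν v hv
      rw [Submodule.mem_orthogonal_singleton_iff_inner_right]
      have h1 := hco i v
      rw [Module.End.mem_eigenspace_iff.mp hv, inner_smul_right] at h1
      have h2 : ((ν : ℂ) - μ i) * ⟪e i, v⟫ = 0 := by rw [sub_mul, h1, sub_self]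
      rcases mul_eq_zero.mp h2 with h | h
      · exfalso
        apply hi
        have : ν = μ i := by exact_mod_cast sub_eq_zero.mp h
        rwa [← this]
      · exact h
    intro w hw
    exact Submodule.mem_orthogonal_singleton_iff_inner_right.mp (this hw)
  obtain ⟨w, hw, z, hz, hp⟩ := W.exists_add_mem_mem_orthogonal p
  have hz' : ∀ y ∈ W, ⟪y, z⟫ = 0 := fun y hy => (Submodule.mem_orthogonal _ _).mp hz y hy
  refine ⟨w, hw, z, hp, hz', W.sub_mem (hinv w hw) (W.smul_mem _ hw), ?_, ?_, ?_⟩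
  · intro y hy
    rw [inner_sub_right, ← hA y z, hz' _ (hinv y hy), inner_smul_right, hz' y hy]
    simp
  · refine le_of_sq_le_sq ?_ (by have := norm_nonneg w; nlinarith)
    rw [mul_pow, ← e.sum_sq_norm_inner_right, ← e.sum_sq_norm_inner_right w, Finset.mul_sum]
    refine Finset.sum_le_sum fun i _ => ?_
    rw [hcol, norm_mul, mul_pow]
    by_cases hi : μ i ∈ Set.Icc a b
    · gcongr
      rw [Complex.norm_real, Real.norm_eq_abs, abs_le]
      constructor <;> linarith [hi.1, hi.2]
    · rw [hout i hi w hw]; simp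
  · intro l c hc h1 h2
    refine le_of_sq_le_sq ?_ (norm_nonneg _)
    rw [mul_pow, ← e.sum_sq_norm_inner_right, ← e.sum_sq_norm_inner_right (A p - _), Finset.mul_sum]
    refine Finset.sum_le_sum fun i _ => ?_
    rw [hcol, norm_mul, mul_pow]
    by_cases hi : μ i ∈ Set.Icc a b
    · rw [hz' _ (hin i hi)]; simp; positivity
    · rw [hp, inner_add_right, hout i hi w hw, zero_add]
      gcongr
      rw [Complex.norm_real, Real.norm_eq_abs, le_abs]
      rw [Set.mem_Icc, not_and_or, not_le, not_le] at hi
      rcases hi with hi | hi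
      · right; linarith
      · left; linarith

section projfacts

variable {K : Type*} [NormedAddCommGroup K] [InnerProductSpace ℂ K] [CompleteSpace K]

theorem aux_sa {P : K →L[ℂ] K} (hsa : IsSelfAdjoint P) (x y : K) : ⟪P x, y⟫ = ⟪x, P y⟫ :=
  (ContinuousLinearMap.isSelfAdjoint_iff_isSymmetric.mp hsa) x y

theorem aux_idem {P : K →L[ℂ] K} (hid : IsIdempotentElem P) (x : K) : P (P x) = P x :=
  congrArg (fun A : K →L[ℂ] K => A x) hid

theorem aux_fix {P : K →L[ℂ] K} (hid : IsIdempotentElem P) {x : K}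
    (hx : x ∈ LinearMap.range P.toLinearMap) : P x = x := by
  obtain ⟨y, rfl⟩ := hx
  exact aux_idem hid y

theorem aux_kill {P : K →L[ℂ] K} (hsa : IsSelfAdjoint P) (hid : IsIdempotentElem P) {x : K}
    (hx : ∀ y ∈ LinearMap.range P.toLinearMap, ⟪y, x⟫ = 0) : P x = 0 := by
  rw [← inner_self_eq_zero (𝕜 := ℂ), aux_sa hsa, aux_idem hid, ← aux_sa hsa]
  exact hx _ ⟨x, rfl⟩

theorem aux_norm {P : K →L[ℂ] K} (hsa : IsSelfAdjoint P) (hid : IsIdempotentElem P) (x : K) :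
    ‖P x‖ ≤ ‖x‖ := by
  have h1 : ‖P x‖ * ‖P x‖ ≤ ‖P x‖ * ‖x‖ := by
    rw [← inner_self_eq_norm_mul_norm (𝕜 := ℂ), aux_sa hsa, aux_idem hid, ← aux_sa hsa]
    exact (Complex.re_le_norm _).trans (norm_inner_le_norm _ _)
  rcases (norm_nonneg (P x)).eq_or_lt with h | h
  · rw [← h]; exact norm_nonneg x
  · exact le_of_mul_le_mul_left h1 h

theorem aux_norm_compl {P : K →L[ℂ] K} (hsa : IsSelfAdjoint P) (hid : IsIdempotentElem P) (x : K) :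
    ‖x - P x‖ ≤ ‖x‖ := by
  have := aux_norm (IsSelfAdjoint.sub (IsSelfAdjoint.one _) hsa) hid.one_sub x
  simpa using this

theorem aux_gap {P : K →L[ℂ] K} (hsa : IsSelfAdjoint P) (hid : IsIdempotentElem P)
    (M N : Submodule ℂ K) (hP : LinearMap.range P.toLinearMap = N) (u : K) (hu : u ∈ M) :
    ‖u - P u‖ ≤ ‖u‖ * gapDelta (M : Set K) (N : Set K) := by
  by_cases h0 : u = 0
  · simp [h0]
  have hn : ‖u‖ ≠ 0 := norm_ne_zero_iff.mpr h0
  set v : K := ((‖u‖⁻¹ : ℝ) : ℂ) • u with hv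
  have hvn : ‖v‖ = 1 := by rw [hv, norm_smul]; simp [hn]
  have hvM : v ∈ M := M.smul_mem _ hu
  have huv : u = ((‖u‖ : ℝ) : ℂ) • v := by
    rw [hv, smul_smul, ← Complex.ofReal_mul, mul_inv_cancel₀ hn]; simp
  have h1 : ‖v - P v‖ ≤ Metric.infDist v (N : Set K) := by
    refine (Metric.le_infDist ⟨0, N.zero_mem⟩).mpr ?_
    intro y hy
    have hPy : P y = y := aux_fix hid (by rw [hP]; exact hy)
    have := aux_norm_compl hsa hid (v - y)
    rw [map_sub, hPy] at this
    rw [dist_eq_norm]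
    convert this using 2
    abel
  have h2 : Metric.infDist v (N : Set K) ≤ gapDelta (M : Set K) (N : Set K) := by
    refine le_csSup ⟨1, ?_⟩ ⟨v, ⟨hvM, hvn⟩, rfl⟩
    rintro _ ⟨x, ⟨_, hx⟩, rfl⟩
    refine (Metric.infDist_le_dist_of_mem N.zero_mem).trans ?_
    rw [dist_zero_right, hx]
  have h3 : u - P u = ((‖u‖ : ℝ) : ℂ) • (v - P v) := by
    rw [smul_sub, ← map_smul, ← huv]
  rw [h3, norm_smul]
  simp only [Complex.norm_real, norm_norm]
  exact mul_le_mul_of_nonneg_left (h1.trans h2) (norm_nonneg _)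

theorem aux_Tl (T : K →L[ℂ] K) (l : ℝ) (v : K) :
    ‖T v - (l : ℂ) • v‖ ≤ (‖T‖ + |l|) * ‖v‖ := by
  refine (norm_sub_le _ _).trans ?_
  rw [add_mul, norm_smul, Complex.norm_real, Real.norm_eq_abs]
  gcongr
  exact T.le_opNorm v

theorem aux_step (T : K →L[ℂ] K) (hT : IsSelfAdjoint T) (N : Submodule ℂ K)
    [FiniteDimensional ℂ N] (P : K →L[ℂ] K) (hPsa : IsSelfAdjoint P) (hPid : IsIdempotentElem P)
    (hP : LinearMap.range P.toLinearMap = N) (A : N →ₗ[ℂ] N)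
    (hA : ∀ x y : N, (⟪y, A x⟫ : ℂ) = ⟪(y : K), T (x : K)⟫) (a b : ℝ) (hab : a < b)
    (Q : K →L[ℂ] K) (hQsa : IsSelfAdjoint Q) (hQid : IsIdempotentElem Q)
    (hQ : LinearMap.range Q.toLinearMap = Submodule.map N.subtype
      (⨆ (μ : ℝ) (_ : μ ∈ Set.Icc a b), Module.End.eigenspace (A : Module.End ℂ N) (μ : ℂ))) :
    (∀ y, ‖Q (T y - (((a + b) / 2 : ℝ) : ℂ) • y)‖
      ≤ (b - a) / 2 * ‖Q y‖ + (‖T‖ + |(a + b) / 2|) * ‖y - P y‖) ∧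
    (∀ l c : ℝ, 0 < c → c ≤ l - a → c ≤ b - l → ∀ u, T u = (l : ℂ) • u →
      ‖u - Q u‖ ≤ (1 + (‖T‖ + |l|) / c) * ‖u - P u‖) := by
  have hAs : A.IsSymmetric := by
    intro x y
    rw [hA, ← inner_conj_symm, hA, inner_conj_symm]
    exact aux_sa hT _ _
  -- the compression applied to vectors
  have hAP : ∀ x : N, ((A x : N) : K) = P (T (x : K)) := by
    intro x
    have hmem : P (T (x : K)) ∈ N := hP.le ⟨_, rfl⟩
    have : A x = ⟨P (T (x : K)), hmem⟩ := by
      refine ext_inner_left ℂ fun y => ?_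
      rw [hA, Submodule.coe_inner]
      change _ = ⟪(y : K), P (T (x : K))⟫
      rw [← aux_sa hPsa, aux_fix hPid (by rw [hP]; exact y.2)]
    rw [this]
  have hAl : ∀ (x : N) (l : ℝ), ((A x - (l : ℂ) • x : N) : K) = P (T (x : K) - (l : ℂ) • (x : K)) := by
    intro x l
    rw [map_sub, map_smul, aux_fix hPid (x := (x : K)) (by rw [hP]; exact x.2), ← hAP]
    rfl
  set W := (⨆ (μ : ℝ) (_ : μ ∈ Set.Icc a b), Module.End.eigenspace (A : Module.End ℂ N) (μ : ℂ))
    with hW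
  have hQfix : ∀ w ∈ W, Q (w : K) = w := by
    intro w hw
    refine aux_fix hQid ?_
    rw [hQ]
    exact ⟨w, hw, rfl⟩
  have hQkill : ∀ z : N, (∀ y ∈ W, ⟪y, z⟫ = 0) → Q (z : K) = 0 := by
    intro z hz
    refine aux_kill hQsa hQid ?_
    rw [hQ]
    rintro _ ⟨y, hy, rfl⟩
    exact hz y hy
  have hQP : ∀ x, Q (P x) = Q x := by
    intro x
    rw [← sub_eq_zero, ← map_sub]
    refine aux_kill hQsa hQid ?_
    rw [hQ]
    rintro _ ⟨y, hy, rfl⟩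
    have : P (y : K) = y := aux_fix hPid (by rw [hP]; exact y.2)
    change ⟪(y : K), P x - x⟫ = 0
    rw [inner_sub_right, ← aux_sa hPsa, this, sub_self]
  have key := fun x : K => aux_fin A hAs a b hab W hW ⟨P x, by rw [← hP]; exact ⟨_, rfl⟩⟩
  have hQw : ∀ (x : K) (w z : N), w ∈ W → (∀ y ∈ W, ⟪y, z⟫ = 0) → P x = w + z → Q x = w := by
    intro x w z hw hz h
    rw [← hQP, h, map_add, hQfix w hw, hQkill z hz, add_zero]
  constructor
  · intro y
    obtain ⟨w, hw, z, hp, hz, hAw, hAz, hb, -⟩ := key y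
    have hp' : P y = (w : K) + z := congrArg (Subtype.val) hp
    have e1 : Q y = w := hQw y w z hw hz hp'
    set m : ℝ := (a + b) / 2
    have e2 : Q (T y - (m : ℂ) • y) = ((A w - (m : ℂ) • w : N) : K)
        + Q (T (y - P y) - (m : ℂ) • (y - P y)) := by
      have e3 : T y - (m : ℂ) • y = (T w - (m : ℂ) • (w : K)) + (T z - (m : ℂ) • (z : K))
        + (T (y - P y) - (m : ℂ) • (y - P y)) := by
        rw [hp']; simp only [map_sub, map_add, smul_sub, smul_add]; abel
      rw [e3, map_add, map_add, ← hQP (T w - _), ← hQP (T z - _), ← hAl, ← hAl, hQfix _ hAw,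
        hQkill _ hAz, add_zero]
    rw [e2]
    refine (norm_add_le _ _).trans (add_le_add ?_ ?_)
    · rw [e1]; exact hb
    · exact (aux_norm hQsa hQid _).trans (aux_Tl T m _)
  · intro l c hc h1 h2 u hu
    obtain ⟨w, hw, z, hp, hz, hAw, hAz, -, hb⟩ := key u
    have hp' : P u = (w : K) + z := congrArg (Subtype.val) hp
    have e1 : Q u = w := hQw u w z hw hz hp'
    have hPu : P u ∈ N := hP.le ⟨_, rfl⟩
    have hb' : c * ‖z‖ ≤ ‖((A ⟨P u, hPu⟩ - (l : ℂ) • ⟨P u, hPu⟩ : N) : K)‖ := hb l c hc.le h1 h2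
    rw [hAl] at hb'
    have e2 : T (P u) - (l : ℂ) • P u = - (T (u - P u) - (l : ℂ) • (u - P u)) := by
      simp only [map_sub, smul_sub, hu]; abel
    have hb2 : c * ‖z‖ ≤ (‖T‖ + |l|) * ‖u - P u‖ := by
      refine hb'.trans ((aux_norm hPsa hPid _).trans ?_)
      change ‖T (P u) - (l : ℂ) • P u‖ ≤ _
      rw [e2, norm_neg]
      exact aux_Tl T l _
    have e3 : u - Q u = (u - P u) + z := by rw [e1, hp']; abel
    rw [e3, add_mul, one_mul, div_mul_eq_mul_div]
    refine (norm_add_le _ _).trans (add_le_add le_rfl ?_)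
    rw [le_div_iff₀ hc, mul_comm]
    exact hb2

end projfacts

/-- **Lemma.** `Q_n → E(Δ)` strongly and `‖(I - Q_n)E(Δ)‖ = O(δ(L(Δ), L_n))`. -/
theorem stmt_16
    -- `T` is a bounded self-adjoint operator
    (T : H →L[ℂ] H) (hsa : IsSelfAdjoint T)
    -- trial spaces with orthogonal projections `P_n → I` strongly
    (L : ℕ → Submodule ℂ H) [∀ n, FiniteDimensional ℂ (L n)]
    (Pn : ℕ → H →L[ℂ] H)
    (hPnsa : ∀ n, IsSelfAdjoint (Pn n)) (hPnidem : ∀ n, IsIdempotentElem (Pn n))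
    (hPnrange : ∀ n, LinearMap.range (Pn n).toLinearMap = L n)
    (hPnconv : ∀ x : H, Tendsto (fun n => Pn n x) atTop (nhds x))
    -- `a, b ∈ ρ(T)`, `Δ = [a,b]`, `Δ ∩ σ(T) = {λ_1,…,λ_d} ⊆ σ_dis(T)`
    (a b : ℝ) (hab : a < b)
    (ha : (a : ℂ) ∈ resolventSet ℂ T) (hb : (b : ℂ) ∈ resolventSet ℂ T)
    (d : ℕ) (lam : Fin d → ℝ)
    (hΔ : (fun x : ℝ => (x : ℂ)) '' Set.Icc a b ∩ spectrum ℂ T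
      = Set.range fun j => ((lam j : ℂ)))
    (hdis : ∀ j, ((lam j : ℂ)) ∈ discSpectrum T)
    -- the eigenvalues are repeated according to multiplicity
    (hmult : ∀ j, Module.finrank ℂ (Module.End.eigenspace (T : H →ₗ[ℂ] H) ((lam j : ℂ)))
      = (Finset.univ.filter fun i => lam i = lam j).card)
    -- `E = E(Δ)` is the spectral projection of `T` for `Δ`, with range `L(Δ)`
    (E : H →L[ℂ] H) (hEsa : IsSelfAdjoint E) (hEidem : IsIdempotentElem E)
    (hErange : LinearMap.range E.toLinearMap
      = ⨆ j, Module.End.eigenspace (T : H →ₗ[ℂ] H) ((lam j : ℂ)))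
    -- `T_n` is the compression `P_n T|_{L_n}`
    (Tn : ∀ n, L n →ₗ[ℂ] L n)
    (hTn : ∀ n, ∀ x y : L n, (⟪y, Tn n x⟫ : ℂ) = ⟪(y : H), T (x : H)⟫)
    -- `Q_n = E_n(Δ) P_n`, the orthogonal projection onto the spectral subspace of `T_n`
    -- for the interval `Δ`
    (Qn : ℕ → H →L[ℂ] H)
    (hQnsa : ∀ n, IsSelfAdjoint (Qn n)) (hQnidem : ∀ n, IsIdempotentElem (Qn n))
    (hQnrange : ∀ n, LinearMap.range (Qn n).toLinearMap = galSpectralSubspace a b L Tn n)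
    :
    (∀ x : H, Tendsto (fun n => Qn n x) atTop (nhds (E x))) ∧
    ∃ C : ℝ, ∀ᶠ n in atTop, ‖(1 - Qn n) * E‖
      ≤ C * gapDelta ((⨆ j, Module.End.eigenspace (T : H →ₗ[ℂ] H) ((lam j : ℂ)) : Submodule ℂ H) : Set H)
          ((L n : Set H)) := by
  classical
  set S : Finset ℝ := Finset.univ.image lam with hSdef
  have haR : a ∉ spectrum ℝ T := by
    rw [← spectrum.algebraMap_mem_iff ℂ]; exact fun h => h ha
  have hbR : b ∉ spectrum ℝ T := by
    rw [← spectrum.algebraMap_mem_iff ℂ]; exact fun h => h hb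
  have hS : Set.Icc a b ∩ spectrum ℝ T = (S : Set ℝ) := by
    ext t
    have h1 : t ∈ Set.Icc a b ∩ spectrum ℝ T ↔
        (t : ℂ) ∈ (fun x : ℝ => (x : ℂ)) '' Set.Icc a b ∩ spectrum ℂ T := by
      rw [Set.mem_inter_iff, Set.mem_inter_iff, ← spectrum.algebraMap_mem_iff ℂ,
        Function.Injective.mem_set_image Complex.ofReal_injective]
      rfl
    rw [h1, hΔ]
    simp [hSdef]
  have hin : ∀ l ∈ S, a < l ∧ l < b := by
    intro l hl
    have : l ∈ Set.Icc a b ∩ spectrum ℝ T := by rw [hS]; exact hl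
    exact ⟨lt_of_le_of_ne this.1.1 (fun h => haR (h ▸ this.2)),
      lt_of_le_of_ne this.1.2 (fun h => hbR (h ▸ this.2))⟩
  obtain ⟨F, G, p, hFsa, hFp, hTp, hFfix, hG, hTG, hFG⟩ :=
    aux_spectral T hsa a b hab haR hbR S hS
  set M : Submodule ℂ H := ⨆ j, Module.End.eigenspace (T : H →ₗ[ℂ] H) ((lam j : ℂ)) with hM
  have hFsum : ∀ x, F x = ∑ l ∈ S, p l x := by
    intro x
    rw [hFp, ContinuousLinearMap.sum_apply]
  have hpM : ∀ l ∈ S, ∀ x, p l x ∈ M := by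
    intro l hl x
    obtain ⟨j, -, rfl⟩ := Finset.mem_image.mp hl
    refine (le_iSup (fun j => Module.End.eigenspace (T : H →ₗ[ℂ] H) ((lam j : ℂ))) j) ?_
    exact Module.End.mem_eigenspace_iff.mpr (hTp _ hl x)
  have hEF : ∀ x, E (F x) = F x := by
    intro x
    refine aux_fix hEidem ?_
    rw [hErange, hFsum]
    exact M.sum_mem fun l hl => hpM l hl x
  have hFE : ∀ x, F (E x) = E x := by
    have h1 : M ≤ LinearMap.eqLocus F.toLinearMap LinearMap.id := by
      refine iSup_le fun j v hv => ?_
      exact hFfix (lam j) (Finset.mem_image_of_mem _ (Finset.mem_univ j)) v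
        (Module.End.mem_eigenspace_iff.mp hv)
    intro x
    exact h1 (hErange.le ⟨x, rfl⟩)
  have hE : ∀ x, E x = F x := by
    intro x
    refine ext_inner_right ℂ fun y => ?_
    rw [← hEF x, aux_sa hEsa (F x), aux_sa hFsa, hFE, aux_sa hEsa]
  -- the basic estimates
  have hst := fun n => aux_step T hsa (L n) (Pn n) (hPnsa n) (hPnidem n) (hPnrange n) (Tn n)
    (hTn n) a b hab (Qn n) (hQnsa n) (hQnidem n) (hQnrange n)
  let C : ℝ → ℝ := fun l => 1 + (‖T‖ + |l|) / min (l - a) (b - l)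
  have hC0 : ∀ l ∈ S, 0 ≤ C l := by
    intro l hl
    have : 0 < min (l - a) (b - l) := lt_min (by linarith [hin l hl]) (by linarith [hin l hl])
    positivity
  have hQP : ∀ n, ∀ l ∈ S, ∀ x, ‖p l x - Qn n (p l x)‖ ≤ C l * ‖p l x - Pn n (p l x)‖ := by
    intro n l hl x
    exact (hst n).2 l (min (l - a) (b - l))
      (lt_min (by linarith [hin l hl]) (by linarith [hin l hl]))
      (min_le_left _ _) (min_le_right _ _) _ (hTp l hl x)
  constructor
  · -- strong convergence
    have hP0 : ∀ x, Tendsto (fun n => ‖x - Pn n x‖) atTop (nhds 0) := by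
      intro x
      have := (tendsto_const_nhds (x := x)).sub (hPnconv x)
      rw [sub_self] at this
      simpa using this.norm
    have hQp : ∀ l ∈ S, ∀ x, Tendsto (fun n => Qn n (p l x)) atTop (nhds (p l x)) := by
      intro l hl x
      rw [tendsto_iff_norm_sub_tendsto_zero]
      have h1 := (hP0 (p l x)).const_mul (C l)
      rw [mul_zero] at h1
      refine squeeze_zero (fun _ => norm_nonneg _) (fun n => ?_) h1
      rw [norm_sub_rev]
      exact hQP n l hl x
    have hr : 0 < (b - a) / 2 := by linarith
    have hker : ∀ k : ℕ, ∀ x, F x = 0 → ∀ ε > 0, ∀ᶠ n in atTop,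
        ‖Qn n x‖ ≤ ‖G‖ ^ k * ‖x‖ + ε := by
      intro k
      induction k with
      | zero =>
        intro x _ ε hε
        refine Eventually.of_forall fun n => ?_
        have := aux_norm (hQnsa n) (hQnidem n) x
        rw [pow_zero, one_mul]
        linarith
      | succ k ih =>
        intro x hx ε hε
        have h1 := ih (G x) (hFG x) (ε / 2) (by linarith)
        have h2 := (hP0 (G x)).const_mul ((‖T‖ + |(a + b) / 2|) / ((b - a) / 2))
        rw [mul_zero] at h2
        have h3 := h2.eventually_le_const (show (0 : ℝ) < ε / 2 by linarith)
        filter_upwards [h1, h3] with n h1 h3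
        have h4 := (hst n).1 (G x)
        rw [hTG, hx, sub_zero, map_smul, norm_smul, Complex.norm_real, Real.norm_eq_abs,
          abs_of_pos hr] at h4
        have h5 : ‖Qn n x‖ ≤ ‖Qn n (G x)‖
            + (‖T‖ + |(a + b) / 2|) / ((b - a) / 2) * ‖G x - Pn n (G x)‖ := by
          refine le_of_mul_le_mul_left (h4.trans (le_of_eq ?_)) hr
          rw [mul_add, ← mul_assoc, mul_div_cancel₀ _ hr.ne']
        have h6 : ‖G‖ ^ k * ‖G x‖ ≤ ‖G‖ ^ (k + 1) * ‖x‖ := by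
          rw [pow_succ, mul_assoc]
          gcongr
          exact G.le_opNorm x
        linarith
    have hker0 : ∀ x, F x = 0 → Tendsto (fun n => Qn n x) atTop (nhds 0) := by
      intro x hx
      rw [Metric.tendsto_nhds]
      intro ε hε
      have h1 : Tendsto (fun k : ℕ => ‖G‖ ^ k * ‖x‖) atTop (nhds 0) := by
        have := (tendsto_pow_atTop_nhds_zero_of_lt_one (norm_nonneg G) hG).mul_const ‖x‖
        rwa [zero_mul] at this
      obtain ⟨k, hk⟩ := (h1.eventually_lt_const (show (0 : ℝ) < ε / 2 by linarith)).exists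
      filter_upwards [hker k x hx (ε / 2) (by linarith)] with n hn
      rw [dist_zero_right]
      linarith
    intro x
    have h1 : Tendsto (fun n => Qn n (F x)) atTop (nhds (F x)) := by
      have := tendsto_finsetSum S (fun l hl => hQp l hl x)
      simp only [← map_sum, ← hFsum] at this
      exact this
    have h2 : Tendsto (fun n => Qn n (x - F x)) atTop (nhds 0) := by
      refine hker0 _ ?_
      rw [map_sub, ← hE x, hFE, sub_self]
    have h3 := h1.add h2
    simp only [← map_add, add_sub_cancel, add_zero] at h3
    rw [hE]
    exact h3
  · refine ⟨∑ l ∈ S, C l * ‖p l‖, Eventually.of_forall fun n => ?_⟩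
    have hg0 : 0 ≤ gapDelta (M : Set H) (L n : Set H) := by
      refine Real.sSup_nonneg ?_
      rintro _ ⟨x, _, rfl⟩
      exact Metric.infDist_nonneg
    refine ContinuousLinearMap.opNorm_le_bound _
      (mul_nonneg (Finset.sum_nonneg fun l hl => mul_nonneg (hC0 l hl) (norm_nonneg _)) hg0) ?_
    intro x
    have e1 : ((1 - Qn n) * E) x = ∑ l ∈ S, (p l x - Qn n (p l x)) := by
      rw [Finset.sum_sub_distrib, ← map_sum, ← hFsum, ← hE]
      rfl
    rw [e1, Finset.sum_mul, Finset.sum_mul]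
    refine (norm_sum_le _ _).trans (Finset.sum_le_sum fun l hl => ?_)
    have h1 := aux_gap (hPnsa n) (hPnidem n) M (L n) (hPnrange n) (p l x) (hpM l hl x)
    calc ‖p l x - Qn n (p l x)‖ ≤ C l * ‖p l x - Pn n (p l x)‖ := hQP n l hl x
      _ ≤ C l * ((‖p l‖ * ‖x‖) * gapDelta (M : Set H) (L n : Set H)) := by
          refine mul_le_mul_of_nonneg_left (h1.trans ?_) (hC0 l hl)
          exact mul_le_mul_of_nonneg_right ((p l).le_opNorm x) hg0
      _ = _ := by ring
end
end

section
/- Let T be a bounded self-adjoint operator and Q_n = E_n(Δ)P_n, where E_n is the spectral measure of P_n T|_{L_n}. Fix 1 ≤ j ≤ d, let e = dim L({λ_j}), and let μ_{n,1}, …, μ_{n,e} be the eigenvalues (repeated according to algebraic multiplicity) of T + iQ_n lying in a sufficiently small neighbourhood of λ_j + i. Then max_{1 ≤ k ≤ e} |μ_{n,k} − λ_j − i| = O(δ(L(Δ), L_n)²) as n → ∞. -/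
open scoped ComplexInnerProductSpace
open Filter

noncomputable section

variable {H : Type*} [NormedAddCommGroup H] [InnerProductSpace ℂ H] [CompleteSpace H]

lemma aux_proj_orth (P : H →L[ℂ] H) (hsa : IsSelfAdjoint P) (hid : IsIdempotentElem P)
    (x y : H) : (⟪x - P x, P y⟫ : ℂ) = 0 := by
  have h1 : P (P x) = P x := by
    have := congrArg (fun A : H →L[ℂ] H => A x) hid
    simpa using this
  have h2 := hsa.isSymmetric (x - P x) y
  simp only [ContinuousLinearMap.coe_coe] at h2
  rw [← h2, map_sub, h1, sub_self, inner_zero_left]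

lemma aux_proj_best (P : H →L[ℂ] H) (hsa : IsSelfAdjoint P) (hid : IsIdempotentElem P)
    (x y : H) (hy : y ∈ LinearMap.range P.toLinearMap) : ‖x - P x‖ ≤ ‖x - y‖ := by
  obtain ⟨z, rfl⟩ := hy
  simp only [ContinuousLinearMap.coe_coe]
  have h := aux_proj_orth P hsa hid x (x - z)
  have h2 := norm_add_sq_eq_norm_sq_add_norm_sq_of_inner_eq_zero _ _ h
  have h3 : x - P x + P (x - z) = x - P z := by rw [map_sub]; abel
  rw [h3] at h2
  nlinarith [norm_nonneg (x - P x), norm_nonneg (x - P z), norm_nonneg (P (x - z))]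

lemma aux_finite {V : Type*} [NormedAddCommGroup V] [InnerProductSpace ℂ V]
    [FiniteDimensional ℂ V] (S : V →ₗ[ℂ] V) (hS : S.IsSymmetric) (a b l c : ℝ)
    (hc : 0 < c) (h1 : c ≤ l - a) (h2 : c ≤ b - l) (p : V) :
    ∃ w ∈ (⨆ (μ : ℝ) (_ : μ ∈ Set.Icc a b), Module.End.eigenspace (S : Module.End ℂ V) (μ : ℂ)),
      c * ‖p - w‖ ≤ ‖S p - (l : ℂ) • p‖ := by
  classical
  set B := hS.eigenvectorBasis rfl with hB
  set ν := hS.eigenvalues (n := Module.finrank ℂ V) rfl with hν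
  set f : Fin (Module.finrank ℂ V) → ℂ := fun i => if ν i ∈ Set.Icc a b then B.repr p i else 0
  refine ⟨∑ i, f i • B i, ?_, ?_⟩
  · refine Submodule.sum_mem _ fun i _ => ?_
    by_cases hi : ν i ∈ Set.Icc a b
    · refine Submodule.smul_mem _ _ ?_
      refine Submodule.mem_iSup_of_mem (ν i) (Submodule.mem_iSup_of_mem hi ?_)
      exact (hS.hasEigenvector_eigenvectorBasis rfl i).1
    · have h0 : f i = 0 := if_neg hi
      rw [h0, zero_smul]; exact Submodule.zero_mem _
  · have e1 : ∀ i, B.repr (p - ∑ i, f i • B i) i = B.repr p i - f i := by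
      intro i
      have := B.sum_repr_symm (WithLp.toLp 2 f)
      have h3 : (∑ i, f i • B i) = B.repr.symm (WithLp.toLp 2 f) := by rw [← this]
      rw [h3]; simp
    have e2 : ∀ i, B.repr (S p - (l : ℂ) • p) i = ((ν i - l : ℝ) : ℂ) * B.repr p i := by
      intro i
      have := hS.eigenvectorBasis_apply_self_apply rfl p i
      rw [map_sub, map_smul]
      simp only [PiLp.sub_apply, PiLp.smul_apply, smul_eq_mul]
      rw [hB, this]; push_cast; rw [← hν]; simp; ring
    rw [← abs_of_pos hc]
    have key : (|c| * ‖p - ∑ i, f i • B i‖) ^ 2 ≤ ‖S p - (l : ℂ) • p‖ ^ 2 := by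
      rw [mul_pow, ← B.repr.norm_map (p - _), ← B.repr.norm_map (S p - _),
        EuclideanSpace.norm_sq_eq, EuclideanSpace.norm_sq_eq, Finset.mul_sum]
      refine Finset.sum_le_sum fun i _ => ?_
      rw [e1, e2, norm_mul, mul_pow, Complex.norm_real, Real.norm_eq_abs, sq_abs, sq_abs]
      by_cases hi : ν i ∈ Set.Icc a b
      · simp only [f, hi, if_true, sub_self, norm_zero]; nlinarith [mul_nonneg (sq_nonneg (ν i - l)) (sq_nonneg ‖B.repr p i‖)]
      · simp only [f, hi, if_false, sub_zero]
        refine mul_le_mul_of_nonneg_right ?_ (sq_nonneg _)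
        have : ν i < a ∨ b < ν i := by
          by_contra! hh; exact hi hh
        rcases this with h | h <;> nlinarith
    exact le_of_sq_le_sq key (norm_nonneg _)

lemma aux_isolated (T : H →L[ℂ] H) (hsa : IsSelfAdjoint T) (l : ℂ)
    (hiso : ∃ ε > 0, ∀ w ∈ spectrum ℂ T, w ≠ l → ε ≤ dist w l) :
    ∃ K ≥ (0 : ℝ), ∀ u : H, ∃ v : H, T v = l • v ∧ ‖u - v‖ ≤ K * ‖T u - l • u‖ := by
  classical
  obtain ⟨ε, hε, hiso⟩ := hiso
  have hn : IsStarNormal T := hsa.isStarNormal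
  have hdisc : ∀ f : ℂ → ℂ, ContinuousOn f {l}ᶜ → ContinuousOn f (spectrum ℂ T) := by
    intro f hf w hw
    by_cases h : w = l
    · subst h
      have : (nhdsWithin w (spectrum ℂ T)) ≤ pure w := by
        rw [le_pure_iff, mem_nhdsWithin]
        refine ⟨Metric.ball w ε, Metric.isOpen_ball, Metric.mem_ball_self hε, ?_⟩
        rintro z ⟨hz, hz2⟩
        by_contra h
        have := hiso z hz2 h
        rw [Metric.mem_ball] at hz
        linarith
      exact (tendsto_pure_nhds f w).mono_left this
    · exact (hf.continuousAt (isOpen_compl_singleton.mem_nhds h)).continuousWithinAt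
  set f : ℂ → ℂ := fun z => (z - l)⁻¹
  set g : ℂ → ℂ := fun z => if z = l then 1 else 0
  have hf : ContinuousOn f (spectrum ℂ T) := hdisc _ (by
    intro z hz
    have : z - l ≠ 0 := sub_ne_zero.mpr hz
    exact ((continuous_id.sub continuous_const).continuousAt.inv₀ this).continuousWithinAt)
  have hg : ContinuousOn g (spectrum ℂ T) := hdisc _ (by
    refine (continuousOn_const (c := (0:ℂ))).congr fun z hz => ?_
    have : z ≠ l := hz
    simp [g, this])
  have hTl : cfc (fun z : ℂ => z - l) T = T - algebraMap ℂ _ l := by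
    rw [cfc_sub (fun z : ℂ => z) (fun _ => l) T, cfc_id' ℂ T, cfc_const l T]
  have hq : ContinuousOn (fun z : ℂ => z - l) (spectrum ℂ T) := by fun_prop
  have m1 : (T - algebraMap ℂ _ l) * cfc g T = 0 := by
    rw [← hTl, ← cfc_mul _ _ T hq hg]
    have : (fun z => (z - l) * g z) = fun _ => 0 := by
      funext z; by_cases h : z = l <;> simp [g, h]
    rw [this, cfc_const_zero]
  have m2 : cfc g T + cfc f T * (T - algebraMap ℂ _ l) = 1 := by
    rw [← hTl, ← cfc_mul _ _ T hf hq, ← cfc_add T g (fun z => f z * (z - l)) hg (hf.mul hq)]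
    have : (fun z => g z + f z * (z - l)) = fun _ => 1 := by
      funext z; by_cases h : z = l
      · simp [g, h]
      · have : z - l ≠ 0 := sub_ne_zero.mpr h
        simp [g, h, f, this]
    rw [this, cfc_const_one ℂ T]
  refine ⟨‖cfc f T‖, norm_nonneg _, fun u => ⟨cfc g T u, ?_, ?_⟩⟩
  · have := congrArg (fun A : H →L[ℂ] H => A u) m1
    simpa [Algebra.algebraMap_eq_smul_one, sub_eq_zero] using this
  · have := congrArg (fun A : H →L[ℂ] H => A u) m2
    simp [Algebra.algebraMap_eq_smul_one] at this
    have h2 : u - cfc g T u = cfc f T (T u - l • u) := by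
      rw [map_sub, map_smul, sub_eq_iff_eq_add', this]
    rw [h2]
    exact ContinuousLinearMap.le_opNorm _ _

lemma aux_eigen (T : H →L[ℂ] H) (hsa : IsSelfAdjoint T) (Q : H →L[ℂ] H)
    (V : Submodule ℂ H) [FiniteDimensional ℂ V] (hQ : ∀ x, Q x ∈ V) (μ : ℂ) (hμ : μ.im ≠ 0)
    (h : μ ∈ spectrum ℂ (T + Complex.I • Q)) :
    ∃ u : H, ‖u‖ = 1 ∧ T u + Complex.I • Q u = μ • u := by
  have hT : IsUnit (algebraMap ℂ (H →L[ℂ] H) μ - T) := by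
    by_contra hc
    have := hsa.mem_spectrum_eq_re (z := μ) hc
    rw [this] at hμ; simp at hμ
  obtain ⟨R, hR⟩ := hT
  set K : H →L[ℂ] H := (↑R⁻¹ : H →L[ℂ] H) * (Complex.I • Q) with hK
  have hQc : IsCompactOperator Q := by
    have : LocallyCompactSpace V := inferInstance
    have h1 : IsCompactOperator (Q.codRestrict V hQ) :=
      isCompactOperator_of_locallyCompactSpace_dom (Q.codRestrict V hQ)
    exact h1.clm_comp V.subtypeL
  have hKc : IsCompactOperator K := (hQc.smul Complex.I).clm_comp (↑R⁻¹ : H →L[ℂ] H)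
  have hfac : algebraMap ℂ (H →L[ℂ] H) μ - (T + Complex.I • Q) = R * (algebraMap ℂ _ 1 - K) := by
    rw [hK, mul_sub, Units.mul_inv_cancel_left, hR]; simp; abel
  have h1 : (1 : ℂ) ∈ spectrum ℂ K := by
    intro hu
    refine h ?_
    change IsUnit _ at hu
    change IsUnit _
    rw [hfac]
    exact R.isUnit.mul hu
  have h2 := (hKc.hasEigenvalue_iff_mem_spectrum one_ne_zero).2 h1
  obtain ⟨w, hw, hw0⟩ := h2.exists_hasEigenvector
  have hw := Module.End.mem_eigenspace_iff.1 hw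
  have hw' : K w = w := by simpa using hw
  have h3 := congrArg (fun A : H →L[ℂ] H => A w) hfac
  have h4 : μ • w - (T w + Complex.I • Q w) = 0 := by
    simpa [Algebra.algebraMap_eq_smul_one, hw'] using h3
  have hn : (‖w‖ : ℂ) ≠ 0 := by simpa using hw0
  refine ⟨(‖w‖ : ℂ)⁻¹ • w, ?_, ?_⟩
  · rw [norm_smul, norm_inv, Complex.norm_real, norm_norm, inv_mul_cancel₀ (norm_ne_zero_iff.2 hw0)]
  · rw [map_smul, map_smul, smul_comm Complex.I, ← smul_add, ← sub_eq_zero.1 h4, smul_comm]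

lemma aux_core (T : H →L[ℂ] H) (hsa : IsSelfAdjoint T) (Q : H →L[ℂ] H)
    (hQsa : IsSelfAdjoint Q) (hQid : IsIdempotentElem Q) (l : ℝ) (K : ℝ) (hK : 0 ≤ K)
    (hv : ∀ u : H, ∃ v : H, T v = (l : ℂ) • v ∧ ‖u - v‖ ≤ K * ‖T u - (l : ℂ) • u‖)
    (G : ℝ) (hG : 0 ≤ G) (hgap : ∀ v : H, T v = (l : ℂ) • v → ‖v - Q v‖ ≤ G * ‖v‖)
    (s : ℝ) (hs : 0 < s) (hs1 : s ≤ 1) (hs2 : K * (2 * s) ≤ 1 / 2)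
    (μ : ℂ) (hμ : dist μ ((l : ℂ) + Complex.I) < s ^ 2)
    (u : H) (hu : ‖u‖ = 1) (he : T u + Complex.I • Q u = μ • u) :
    dist μ ((l : ℂ) + Complex.I) ≤ 16 * G ^ 2 := by
  set D := dist μ ((l : ℂ) + Complex.I) with hD
  have hD0 : 0 ≤ D := dist_nonneg
  have hDn : ‖μ - ((l : ℂ) + Complex.I)‖ = D := (dist_eq_norm _ _).symm
  set t := ‖u - Q u‖ with ht
  have ht0 : 0 ≤ t := norm_nonneg _
  -- the imaginary part
  have hQQ : (⟪u, Q u⟫ : ℂ) = (‖Q u‖ ^ 2 : ℝ) := by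
    have h := aux_proj_orth Q hQsa hQid u u
    rw [inner_sub_left, sub_eq_zero] at h
    rw [h, inner_self_eq_norm_sq_to_K]; simp
  have hpy : t ^ 2 + ‖Q u‖ ^ 2 = 1 := by
    have h := norm_add_sq_eq_norm_sq_add_norm_sq_of_inner_eq_zero _ _ (aux_proj_orth Q hQsa hQid u u)
    rw [sub_add_cancel, hu] at h
    nlinarith
  have hTim : (⟪u, T u⟫ : ℂ).im = 0 := by
    have h := hsa.isSymmetric u u
    simp only [ContinuousLinearMap.coe_coe] at h
    have h2 := inner_conj_symm (𝕜 := ℂ) u (T u)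
    rw [h] at h2
    exact Complex.conj_eq_iff_im.1 h2
  have him : μ.im = ‖Q u‖ ^ 2 := by
    have h := congrArg (fun x => (⟪u, x⟫ : ℂ).im) he
    simp only [inner_add_right, inner_smul_right, hQQ, inner_self_eq_norm_sq_to_K, hu] at h
    simp [hTim] at h
    rw [← h, ← Complex.ofReal_pow, Complex.ofReal_re]
  have htD : t ^ 2 ≤ D := by
    have h := Complex.abs_im_le_norm (μ - ((l : ℂ) + Complex.I))
    rw [hDn] at h
    simp [him] at h
    have := (abs_le.1 h).1
    linarith
  have hts : t ≤ s := by nlinarith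
  obtain ⟨v, hTv, hvu⟩ := hv u
  have hTl : T u - (l : ℂ) • u = (μ - ((l : ℂ) + Complex.I)) • u + Complex.I • (u - Q u) := by
    rw [sub_smul, add_smul, ← he, smul_sub]; abel
  have hTln : ‖T u - (l : ℂ) • u‖ ≤ 2 * s := by
    rw [hTl]
    refine (norm_add_le _ _).trans ?_
    rw [norm_smul, norm_smul, hDn, hu, Complex.norm_I]
    nlinarith
  have huv : ‖u - v‖ ≤ 1 / 2 := hvu.trans ((mul_le_mul_of_nonneg_left hTln hK).trans hs2)
  have hvn : ‖v‖ ≤ 2 := by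
    have h := norm_sub_le u (u - v)
    rw [sub_sub_cancel, hu] at h
    linarith
  have hin : 1 / 2 ≤ ‖(⟪v, u⟫ : ℂ)‖ := by
    have h1 : (⟪v, u⟫ : ℂ) = 1 - ⟪u - v, u⟫ := by
      rw [inner_sub_left, inner_self_eq_norm_sq_to_K, hu]; simp
    have h2 : ‖(⟪u - v, u⟫ : ℂ)‖ ≤ 1 / 2 := by
      refine (norm_inner_le_norm _ _).trans ?_
      rw [hu]; linarith
    have h3 := norm_sub_norm_le (1 : ℂ) ⟪u - v, u⟫
    rw [← h1, norm_one] at h3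
    linarith
  have hT2 : (⟪v, T u⟫ : ℂ) = l * ⟪v, u⟫ := by
    have h := hsa.isSymmetric v u
    simp only [ContinuousLinearMap.coe_coe] at h
    rw [← h, hTv, inner_smul_left]; simp
  have horth : (⟪v, u - Q u⟫ : ℂ) = ⟪v - Q v, u - Q u⟫ := by
    have h := aux_proj_orth Q hQsa hQid u v
    have h' : (⟪Q v, u - Q u⟫ : ℂ) = 0 := by rw [← inner_conj_symm, h]; simp
    rw [inner_sub_left v, h', sub_zero]
  have hmain : (μ - ((l : ℂ) + Complex.I)) * ⟪v, u⟫ = - (Complex.I * ⟪v - Q v, u - Q u⟫) := by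
    rw [← horth]
    have h := congrArg (fun x => (⟪v, x⟫ : ℂ)) hTl
    simp only [inner_sub_right v (T u), inner_add_right, inner_smul_right, hT2] at h
    linear_combination -h
  have hm : D * ‖(⟪v, u⟫ : ℂ)‖ ≤ G * 2 * t := by
    have h := congrArg norm hmain
    rw [norm_mul, hDn, norm_neg, norm_mul, Complex.norm_I, one_mul] at h
    rw [h]
    refine (norm_inner_le_norm _ _).trans ?_
    refine mul_le_mul_of_nonneg_right ((hgap v hTv).trans ?_) ht0
    exact mul_le_mul_of_nonneg_left hvn hG
  have hm2 : D ≤ 4 * G * t := by nlinarith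
  have hm3 : D * D ≤ (16 * G ^ 2) * D := by
    have : D * D ≤ (4 * G * t) * (4 * G * t) := mul_self_le_mul_self hD0 hm2
    have h5 : G ^ 2 * t ^ 2 ≤ G ^ 2 * D := mul_le_mul_of_nonneg_left htD (sq_nonneg _)
    nlinarith
  rcases hD0.eq_or_lt with h | h
  · rw [← h]; positivity
  · exact le_of_mul_le_mul_right hm3 h

/-- **Lemma.** The non-real eigenvalues of `T + iQ_n` near `λ_j + i` satisfy
`max_k |μ_{n,k} - λ_j - i| = O(δ(L(Δ), L_n)²)`. -/
theorem stmt_17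
    -- `T` is a bounded self-adjoint operator
    (T : H →L[ℂ] H) (hsa : IsSelfAdjoint T)
    -- trial spaces with orthogonal projections `P_n → I` strongly
    (L : ℕ → Submodule ℂ H) [∀ n, FiniteDimensional ℂ (L n)]
    (Pn : ℕ → H →L[ℂ] H)
    (hPnsa : ∀ n, IsSelfAdjoint (Pn n)) (hPnidem : ∀ n, IsIdempotentElem (Pn n))
    (hPnrange : ∀ n, LinearMap.range (Pn n).toLinearMap = L n)
    (hPnconv : ∀ x : H, Tendsto (fun n => Pn n x) atTop (nhds x))
    -- `a, b ∈ ρ(T)`, `Δ = [a,b]`, `Δ ∩ σ(T) = {λ_1,…,λ_d} ⊆ σ_dis(T)`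
    (a b : ℝ) (hab : a < b)
    (ha : (a : ℂ) ∈ resolventSet ℂ T) (hb : (b : ℂ) ∈ resolventSet ℂ T)
    (d : ℕ) (lam : Fin d → ℝ)
    (hΔ : (fun x : ℝ => (x : ℂ)) '' Set.Icc a b ∩ spectrum ℂ T
      = Set.range fun j => ((lam j : ℂ)))
    (hdis : ∀ j, ((lam j : ℂ)) ∈ discSpectrum T)
    -- the eigenvalues are repeated according to multiplicity
    (hmult : ∀ j, Module.finrank ℂ (Module.End.eigenspace (T : H →ₗ[ℂ] H) ((lam j : ℂ)))
      = (Finset.univ.filter fun i => lam i = lam j).card)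
    -- `E = E(Δ)` is the spectral projection of `T` for `Δ`, with range `L(Δ)`
    (E : H →L[ℂ] H) (hEsa : IsSelfAdjoint E) (hEidem : IsIdempotentElem E)
    (hErange : LinearMap.range E.toLinearMap
      = ⨆ j, Module.End.eigenspace (T : H →ₗ[ℂ] H) ((lam j : ℂ)))
    -- `T_n` is the compression `P_n T|_{L_n}`
    (Tn : ∀ n, L n →ₗ[ℂ] L n)
    (hTn : ∀ n, ∀ x y : L n, (⟪y, Tn n x⟫ : ℂ) = ⟪(y : H), T (x : H)⟫)
    -- `Q_n = E_n(Δ) P_n`, the orthogonal projection onto the spectral subspace of `T_n`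
    -- for the interval `Δ`
    (Qn : ℕ → H →L[ℂ] H)
    (hQnsa : ∀ n, IsSelfAdjoint (Qn n)) (hQnidem : ∀ n, IsIdempotentElem (Qn n))
    (hQnrange : ∀ n, LinearMap.range (Qn n).toLinearMap = galSpectralSubspace a b L Tn n)
    (j : Fin d) :
    ∃ r₀ > (0 : ℝ), ∃ C : ℝ, ∀ᶠ n in atTop,
      ∀ μ ∈ spectrum ℂ (T + Complex.I • Qn n),
        dist μ ((lam j : ℂ) + Complex.I) < r₀ →
        dist μ ((lam j : ℂ) + Complex.I)
          ≤ C * (gapDelta ((⨆ j, Module.End.eigenspace (T : H →ₗ[ℂ] H) ((lam j : ℂ)) : Submodule ℂ H) : Set H)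
              ((L n : Set H))) ^ 2 := by
  classical
  set M : Submodule ℂ H := ⨆ j, Module.End.eigenspace (T : H →ₗ[ℂ] H) ((lam j : ℂ)) with hM
  set l := lam j with hl
  obtain ⟨hspec, hiso, -, -⟩ := hdis j
  obtain ⟨K, hK, hv⟩ := aux_isolated T hsa (l : ℂ) hiso
  have hlΔ : l ∈ Set.Icc a b := by
    have h : (l : ℂ) ∈ Set.range fun j => ((lam j : ℂ)) := ⟨j, rfl⟩
    rw [← hΔ] at h
    obtain ⟨⟨x, hx, hxl⟩, -⟩ := h
    have : x = l := Complex.ofReal_injective hxl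
    rwa [← this]
  have hla : a < l := by
    refine lt_of_le_of_ne hlΔ.1 fun h => ?_
    rw [h] at ha
    exact hspec ha
  have hlb : l < b := by
    refine lt_of_le_of_ne hlΔ.2 fun h => ?_
    rw [← h] at hb
    exact hspec hb
  set c := min (l - a) (b - l) with hc
  have hc0 : 0 < c := lt_min (by linarith) (by linarith)
  set N := ‖T - (l : ℂ) • (1 : H →L[ℂ] H)‖ with hN
  have hN0 : 0 ≤ N := norm_nonneg _
  set A := 1 + N / c with hA
  have hA0 : 0 ≤ A := by positivity
  set s := 1 / (4 * (K + 1)) with hs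
  have hs0 : 0 < s := by positivity
  have hs1 : s ≤ 1 := by
    rw [hs, div_le_one (by positivity)]; linarith
  have hs2 : K * (2 * s) ≤ 1 / 2 := by
    have : s * (4 * (K + 1)) = 1 := by rw [hs]; field_simp
    nlinarith
  refine ⟨s ^ 2, by positivity, 16 * A ^ 2, Eventually.of_forall fun n μ hμ hd => ?_⟩
  set δ := gapDelta (M : Set H) (L n : Set H) with hδ
  have hδ0 : 0 ≤ δ := by
    refine Real.sSup_nonneg ?_
    rintro _ ⟨x, -, rfl⟩
    exact Metric.infDist_nonneg
  have hbdd : BddAbove ((fun x => Metric.infDist x (L n : Set H)) '' {x ∈ (M : Set H) | ‖x‖ = 1}) := by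
    refine ⟨1, ?_⟩
    rintro _ ⟨x, hx, rfl⟩
    have h := Metric.infDist_le_dist_of_mem (x := x) (L n).zero_mem
    rw [dist_zero_right, hx.2] at h
    exact h
  have hP : ∀ v ∈ M, ‖v‖ = 1 → ‖v - Pn n v‖ ≤ δ := by
    intro v hvM hv1
    have h1 : Metric.infDist v (L n : Set H) ≤ δ := le_csSup hbdd ⟨v, ⟨hvM, hv1⟩, rfl⟩
    refine le_trans ?_ h1
    refine (Metric.le_infDist ⟨0, (L n).zero_mem⟩).2 fun y hy => ?_
    rw [dist_eq_norm]
    refine aux_proj_best _ (hPnsa n) (hPnidem n) _ _ ?_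
    rw [hPnrange]; exact hy
  have hPL : ∀ x, Pn n x ∈ L n := fun x => by
    rw [← hPnrange n]; exact ⟨x, rfl⟩
  have hPfix : ∀ x : L n, Pn n (x : H) = x := by
    intro x
    have h := aux_proj_best _ (hPnsa n) (hPnidem n) (x : H) x (by rw [hPnrange]; exact x.2)
    rw [sub_self, norm_zero] at h
    exact (sub_eq_zero.1 (norm_le_zero_iff.1 h)).symm
  have hsym : (Tn n).IsSymmetric := by
    intro x y
    have h1 := hTn n x y
    have h2 := hTn n y x
    have h3 := hsa.isSymmetric (x : H) (y : H)
    simp only [ContinuousLinearMap.coe_coe] at h3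
    rw [h2, ← h3, ← inner_conj_symm, h1, inner_conj_symm]
  have hgap1 : ∀ v, T v = (l : ℂ) • v → ‖v‖ = 1 → ‖v - Qn n v‖ ≤ A * δ := by
    intro v hTv hv1
    have hvM : v ∈ M := by
      refine Submodule.mem_iSup_of_mem j ?_
      rw [Module.End.mem_eigenspace_iff]; exact hTv
    have hPv := hP v hvM hv1
    set p : L n := ⟨Pn n v, hPL v⟩ with hp
    obtain ⟨w, hw, hwp⟩ := aux_finite (Tn n) hsym a b l c hc0 (min_le_left _ _) (min_le_right _ _) p
    have hres : ‖Tn n p - (l : ℂ) • p‖ ≤ N * δ := by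
      set z := Tn n p - (l : ℂ) • p with hz
      have h1 : (⟪z, z⟫ : ℂ) = ⟪(z : H), (T - (l : ℂ) • (1 : H →L[ℂ] H)) ((p : H) - v)⟫ := by
        have e : (T - (l : ℂ) • (1 : H →L[ℂ] H)) ((p : H) - v) = T (p : H) - (l : ℂ) • (p : H) := by
          simp [hTv, smul_sub]
        rw [e, inner_sub_right (z : H), ← hTn, ← Submodule.coe_smul, ← Submodule.coe_inner, ← inner_sub_right, ← hz]
      have h2 : ‖z‖ * ‖z‖ ≤ (N * δ) * ‖z‖ := by
        have h3 := congrArg norm h1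
        rw [inner_self_eq_norm_sq_to_K] at h3
        have h4 : ‖z‖ * ‖z‖ = ‖((‖z‖ : ℂ)) ^ 2‖ := by simp [sq]
        rw [h4]
        refine h3.le.trans ((norm_inner_le_norm _ _).trans ?_)
        rw [mul_comm]
        refine mul_le_mul_of_nonneg_right ?_ (norm_nonneg _)
        refine (ContinuousLinearMap.le_opNorm _ _).trans ?_
        refine mul_le_mul_of_nonneg_left ?_ hN0
        rw [norm_sub_rev]; exact hPv
      rcases (norm_nonneg z).eq_or_lt with h | h
      · rw [← h]; positivity
      · exact le_of_mul_le_mul_right h2 h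
    have h5 : ‖p - w‖ ≤ N / c * δ := by
      rw [div_mul_eq_mul_div, le_div_iff₀ hc0]; linarith
    have h6 : ‖v - Qn n v‖ ≤ ‖v - (w : H)‖ := by
      refine aux_proj_best _ (hQnsa n) (hQnidem n) _ _ ?_
      rw [hQnrange n]
      exact Submodule.mem_map_of_mem (f := (L n).subtype) hw
    have h7 : v - (w : H) = (v - Pn n v) + ((p - w : L n) : H) := by
      simp [hp]
    rw [h7] at h6
    refine h6.trans ((norm_add_le _ _).trans ?_)
    rw [Submodule.norm_coe, hA]
    linarith
  have hgap : ∀ v, T v = (l : ℂ) • v → ‖v - Qn n v‖ ≤ (A * δ) * ‖v‖ := by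
    intro v hTv
    by_cases h0 : v = 0
    · simp [h0]
    have hn : 0 < ‖v‖ := norm_pos_iff.2 h0
    have h := hgap1 ((‖v‖ : ℂ)⁻¹ • v) (by rw [map_smul, hTv, smul_comm])
      (by rw [norm_smul, norm_inv, Complex.norm_real, norm_norm, inv_mul_cancel₀ hn.ne'])
    rw [map_smul, ← smul_sub, norm_smul, norm_inv, Complex.norm_real, norm_norm,
      inv_mul_le_iff₀ hn] at h
    linarith
  have hQV : ∀ x, Qn n x ∈ L n := by
    intro x
    have h : Qn n x ∈ galSpectralSubspace a b L Tn n := by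
      rw [← hQnrange n]; exact ⟨x, rfl⟩
    obtain ⟨y, -, hy⟩ := h
    rw [← hy]; exact y.2
  have hμim : μ.im ≠ 0 := by
    intro h0
    have h := Complex.abs_im_le_norm (μ - ((l : ℂ) + Complex.I))
    rw [← dist_eq_norm] at h
    simp [h0] at h
    nlinarith
  obtain ⟨u, hu, he⟩ := aux_eigen T hsa (Qn n) (L n) hQV μ hμim hμ
  have := aux_core T hsa (Qn n) (hQnsa n) (hQnidem n) l K hK hv (A * δ) (by positivity) hgap
    s hs0 hs1 hs2 μ hd u hu he
  rw [mul_pow] at this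
  linarith
end
end
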